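/- arXiv:2603.16055 — 5 statements merged into one kernel-verified Lean document; each statement's English description precedes it below -/
import Mathlib

section
/- The limit lim_{h→0⁺} V(h) exists and is finite, where V(h) := sup_σ R(σ, h) is the asymptotic value of the POMDP with stage duration h. -/
open Filter

/-- A POMDP (data only): deterministic signal map `f`, stage payoff `g`,
transition kernel `P`, and initial distribution `p1`. -/
structure POMDP (Ω A S : Type*) where
  f : Ω → S
  g : Ω → A → ℝ
  P : Ω → A → Ω → ℝ
  p1 : Ω → ℝ

/-- A history `(s₁, a₁, …, a_{t-1}, s_t)`, encoded as the reversed list of past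
(signal, action) pairs together with the current signal. -/
abbrev Hist (S A : Type*) := List (S × A) × S

/-- A behavior strategy (data only): a mixed action for every finite history. -/
abbrev Strategy (S A : Type*) := Hist S A → A → ℝ

/-- `σ η ∈ Δ(A)` for every history `η`. -/
def IsStrategy {S A : Type*} [Fintype A] (σ : Strategy S A) : Prop :=
  (∀ η a, 0 ≤ σ η a) ∧ ∀ η, ∑ a, σ η a = 1

namespace POMDP

variable {Ω A S : Type*} [Fintype Ω] [Fintype A]

/-- `P ω a ∈ Δ(Ω)` for every `(ω, a)`, and `p1 ∈ Δ(Ω)`. -/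
def IsValid (M : POMDP Ω A S) : Prop :=
  (∀ ω a ω', 0 ≤ M.P ω a ω') ∧ (∀ ω a, ∑ ω', M.P ω a ω' = 1) ∧
    (∀ ω, 0 ≤ M.p1 ω) ∧ ∑ ω, M.p1 ω = 1

/-- The observable history determined by a reversed past trajectory and the
current state. -/
def obs (M : POMDP Ω A S) (rev : List (Ω × A)) (ω : Ω) : Hist S A :=
  (rev.map fun p => (M.f p.1, p.2), M.f ω)

/-- Probability of a finite trajectory `(ω₁, a₁, …, ω_t, a_t)` under a strategy,
the trajectory being given in reverse order (the head of the list is the most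
recent (state, action) pair). -/
def trajP (M : POMDP Ω A S) (σ : Strategy S A) : List (Ω × A) → ℝ
  | [] => 1
  | (ω, a) :: rest =>
      (match rest with
        | [] => M.p1 ω
        | (ω', a') :: _ => M.P ω' a' ω) *
        σ (M.obs rest ω) a * trajP M σ rest

/-- The expected stage-`(n+1)` payoff `E_σ[g(ω_{n+1}, a_{n+1})]`. -/
noncomputable def stageE (M : POMDP Ω A S) (σ : Strategy S A) (n : ℕ) : ℝ :=
  ∑ tr : Fin (n + 1) → Ω × A, trajP M σ (List.ofFn tr) * M.g (tr 0).1 (tr 0).2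

/-- The expected long-run average payoff
`R(σ) = liminf_T E_σ[(1/T) ∑_{i=1}^T g(ω_i, a_i)]`. -/
noncomputable def R (M : POMDP Ω A S) (σ : Strategy S A) : ℝ :=
  liminf (fun T : ℕ => (1 / (T : ℝ)) * ∑ n ∈ Finset.range T, stageE M σ n) atTop

/-- The POMDP `G_h` with stage duration `h`:
`P_h(⬝|ω,a) = h·P(⬝|ω,a) + (1-h)·δ_ω`. -/
def dur [DecidableEq Ω] (M : POMDP Ω A S) (h : ℝ) : POMDP Ω A S :=
  { M with P := fun ω a ω' => h * M.P ω a ω' + (1 - h) * (if ω' = ω then 1 else 0) }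

/-- The asymptotic value `V(h) = sup_σ R(σ, h)` of `G_h`. -/
noncomputable def V [DecidableEq Ω] (M : POMDP Ω A S) (h : ℝ) : ℝ :=
  sSup {r | ∃ σ : Strategy S A, IsStrategy σ ∧ r = (M.dur h).R σ}

end POMDP

namespace POMDP

section ListSums

variable {X : Type*} [Fintype X]

/-- The sum of `F` over all lists of length `n`. -/
def listSum (n : ℕ) (F : List X → ℝ) : ℝ := ∑ tr : Fin n → X, F (List.ofFn tr)

lemma listSum_zero (F : List X → ℝ) : listSum 0 F = F [] := by
  simp [listSum]

lemma listSum_succ (n : ℕ) (F : List X → ℝ) :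
    listSum (n + 1) F = ∑ x, listSum n fun l => F (x :: l) := by
  unfold listSum
  rw [← Fintype.sum_prod_type', ← (Fin.consEquiv fun _ : Fin (n + 1) => X).sum_comp]
  simp [Fin.consEquiv, List.ofFn_succ]

lemma listSum_add (n : ℕ) (F G : List X → ℝ) :
    listSum n (fun l => F l + G l) = listSum n F + listSum n G :=
  Finset.sum_add_distrib

lemma listSum_mul_left (n : ℕ) (c : ℝ) (F : List X → ℝ) :
    listSum n (fun l => c * F l) = c * listSum n F :=
  (Finset.mul_sum _ _ _).symm

lemma listSum_sum {ι : Type*} (s : Finset ι) (n : ℕ) (F : ι → List X → ℝ) :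
    listSum n (fun l => ∑ i ∈ s, F i l) = ∑ i ∈ s, listSum n (F i) :=
  Finset.sum_comm

lemma listSum_nonneg {n : ℕ} {F : List X → ℝ} (h : ∀ l, 0 ≤ F l) : 0 ≤ listSum n F :=
  Finset.sum_nonneg fun _ _ => h _

lemma hasSum_listSum {n : ℕ} {F : ℕ → List X → ℝ} {G : List X → ℝ}
    (h : ∀ l, HasSum (fun i => F i l) (G l)) :
    HasSum (fun i => listSum n (F i)) (listSum n G) :=
  hasSum_sum fun _ _ => h _

end ListSums

section Binomial

/-- `binom q n f` is the expectation of `f` under the binomial distribution of parameters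
`n` and `q`. -/
def binom (q : ℝ) : ℕ → (ℕ → ℝ) → ℝ
  | 0, f => f 0
  | n + 1, f => binom q n fun j => q * f (j + 1) + (1 - q) * f j

lemma binom_add (q : ℝ) (n : ℕ) (f g : ℕ → ℝ) :
    binom q n (fun j => f j + g j) = binom q n f + binom q n g := by
  induction n generalizing f g with
  | zero => rfl
  | succ n ih =>
    simp only [binom]
    rw [← ih]
    congr 1
    ext j
    ring

lemma binom_mul_left (q : ℝ) (n : ℕ) (c : ℝ) (f : ℕ → ℝ) :
    binom q n (fun j => c * f j) = c * binom q n f := by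
  induction n generalizing f with
  | zero => rfl
  | succ n ih =>
    simp only [binom]
    rw [← ih]
    congr 1
    ext j
    ring

lemma binom_const (q : ℝ) (n : ℕ) (c : ℝ) : binom q n (fun _ => c) = c := by
  induction n with
  | zero => rfl
  | succ n ih =>
    simp only [binom]
    rw [show q * c + (1 - q) * c = c by ring, ih]

lemma binom_mono {q : ℝ} (h0 : 0 ≤ q) (h1 : q ≤ 1) (n : ℕ) {f g : ℕ → ℝ}
    (h : ∀ j, f j ≤ g j) : binom q n f ≤ binom q n g := by
  induction n generalizing f g with
  | zero => exact h 0
  | succ n ih =>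
    exact ih fun j => add_le_add (mul_le_mul_of_nonneg_left (h _) h0)
      (mul_le_mul_of_nonneg_left (h _) (sub_nonneg.2 h1))

lemma binom_cast (q : ℝ) (n : ℕ) : binom q n (fun j => (j : ℝ)) = n * q := by
  induction n with
  | zero => simp [binom]
  | succ n ih =>
    simp only [binom]
    have : (fun j : ℕ => q * ((j + 1 : ℕ) : ℝ) + (1 - q) * j) = fun j : ℕ => (j : ℝ) + q := by
      ext j
      push_cast
      ring
    rw [this, binom_add, ih, binom_const]
    push_cast
    ring

lemma binom_sq (q : ℝ) (n : ℕ) (c : ℝ) :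
    binom q n (fun j => ((j : ℝ) - c) ^ 2) = (n * q - c) ^ 2 + n * q * (1 - q) := by
  induction n generalizing c with
  | zero => simp [binom]
  | succ n ih =>
    simp only [binom]
    have : (fun j : ℕ => q * (((j + 1 : ℕ) : ℝ) - c) ^ 2 + (1 - q) * ((j : ℝ) - c) ^ 2) =
        fun j : ℕ => ((j : ℝ) - (c - q)) ^ 2 + q * (1 - q) := by
      ext j
      push_cast
      ring
    rw [this, binom_add, ih, binom_const]
    push_cast
    ring

lemma sum_binom_lt (q : ℝ) (N T : ℕ) :
    ∑ n ∈ Finset.range N, q * binom q n (fun j => if j < T then 1 else 0) =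
      binom q N (fun j => ((min j T : ℕ) : ℝ)) := by
  induction N with
  | zero => simp [binom]
  | succ N ih =>
    rw [Finset.sum_range_succ, ih, ← binom_mul_left, ← binom_add]
    simp only [binom]
    congr 1
    ext j
    split_ifs with h
    · rw [min_eq_left h.le, min_eq_left (by omega)]
      push_cast
      ring
    · rw [min_eq_right (by omega), min_eq_right (by omega)]
      ring

lemma le_binom_min {q : ℝ} (h0 : 0 ≤ q) (h1 : q ≤ 1) (N T : ℕ) (hT : N * q ≤ T) :
    N * q - √N ≤ binom q N (fun j => ((min j T : ℕ) : ℝ)) := by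
  rcases Nat.eq_zero_or_pos N with rfl | hN
  · simp [binom]
  have hs : 0 < √(N : ℝ) := Real.sqrt_pos.2 (by exact_mod_cast hN)
  have hss : √(N : ℝ) * √N = N := Real.mul_self_sqrt (Nat.cast_nonneg N)
  have key : binom q N (fun j => (j : ℝ)) ≤ binom q N (fun j => ((min j T : ℕ) : ℝ) +
      ((1 / (2 * √N)) * ((j : ℝ) - N * q) ^ 2 + √N / 2)) := by
    refine binom_mono h0 h1 N fun j => ?_
    have e : (1 / (2 * √N)) * ((j : ℝ) - N * q) ^ 2 + √N / 2 - (j - N * q) =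
        (1 / (2 * √N)) * ((j : ℝ) - N * q - √N) ^ 2 := by
      field_simp
      ring
    have p1 : 0 ≤ (1 / (2 * √N)) * ((j : ℝ) - N * q - √N) ^ 2 := by positivity
    have p2 : 0 ≤ (1 / (2 * √N)) * ((j : ℝ) - N * q) ^ 2 + √N / 2 := by positivity
    rcases le_total j T with h | h
    · rw [min_eq_left h]
      linarith
    · rw [min_eq_right h]
      linarith
  rw [binom_cast, binom_add, binom_add, binom_mul_left, binom_sq, binom_const] at key
  have e : 1 / (2 * √N) * ((N * q - N * q) ^ 2 + N * q * (1 - q)) = √N / 2 * (q * (1 - q)) := by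
    rw [sub_self]
    nth_rewrite 2 [← hss]
    field_simp
    ring
  have : q * (1 - q) ≤ 1 := by nlinarith
  have : √N / 2 * (q * (1 - q)) ≤ √N / 2 * 1 := by gcongr
  linarith

end Binomial

section Memory

variable {S A : Type*} [Fintype A]

/-- The effect on test functions of playing `a` under `σ` at the current signal `s`. -/
def act (σ : Strategy S A) (s : S) (a : A) :
    (List (S × A) → ℝ) →ₗ[ℝ] (List (S × A) → ℝ) where
  toFun F ξ := σ (ξ, s) a * F ((s, a) :: ξ)
  map_add' F G := by ext; simp [mul_add]
  map_smul' c F := by ext; simp [mul_left_comm]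

/-- Starting from (graded) weights `μ` on simulated histories, the weights obtained after
inserting idle stages, each of which occurs with probability `1 - q`, at the signal `s`. -/
def idle (q : ℝ) (σ : Strategy S A) (s : S) (μ : ℕ → (List (S × A) → ℝ) →ₗ[ℝ] ℝ) :
    ℕ → (List (S × A) → ℝ) →ₗ[ℝ] ℝ
  | 0 => μ 0
  | n + 1 => μ (n + 1) + (1 - q) • (idle q σ s μ n ∘ₗ ∑ a, act σ s a)

/-- The weights on simulated histories of length `n` which end at an active stage and whose
active stages form the (reversed) history `l`. -/
def sim (q : ℝ) (σ : Strategy S A) : List (S × A) → ℕ → (List (S × A) → ℝ) →ₗ[ℝ] ℝ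
  | [], 0 => LinearMap.proj []
  | [], _ + 1 => 0
  | _ :: _, 0 => 0
  | (s, a) :: l, n + 1 => q • (idle q σ s (sim q σ l) n ∘ₗ act σ s a)

/-- The total weight of the simulated histories whose active stages form `l`. -/
noncomputable def simMass (q : ℝ) (σ : Strategy S A) (l : List (S × A)) : ℝ :=
  ∑' n, sim q σ l n 1

open Classical in
/-- The behavior strategy which simulates `σ` on a game slowed down by the factor `q`. -/
noncomputable def simStrategy (q : ℝ) (σ : Strategy S A) : Strategy S A := fun η a =>
  if simMass q σ η.1 = 0 then σ η a else simMass q σ ((η.2, a) :: η.1) / simMass q σ η.1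

variable {q : ℝ} {σ : Strategy S A}

lemma act_nonneg (hσ : IsStrategy σ) (s : S) (a : A) {F : List (S × A) → ℝ} (hF : 0 ≤ F) :
    0 ≤ act σ s a F :=
  fun _ => mul_nonneg (hσ.1 _ _) (hF _)

lemma sum_act_one (hσ : IsStrategy σ) (s : S) : ∑ a, act σ s a 1 = 1 := by
  ext ξ
  simp [act, hσ.2]

lemma idle_nonneg (h1 : q ≤ 1) (hσ : IsStrategy σ) (s : S)
    {μ : ℕ → (List (S × A) → ℝ) →ₗ[ℝ] ℝ} (hμ : ∀ n F, 0 ≤ F → 0 ≤ μ n F)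
    (n : ℕ) {F : List (S × A) → ℝ} (hF : 0 ≤ F) : 0 ≤ idle q σ s μ n F := by
  induction n generalizing F with
  | zero => exact hμ _ _ hF
  | succ n ih =>
    have : 0 ≤ ∑ a, act σ s a F := Finset.sum_nonneg fun a _ => act_nonneg hσ s a hF
    have h2 := ih this
    have h3 := hμ (n + 1) F hF
    have h4 := mul_nonneg (sub_nonneg.2 h1) h2
    simpa [idle] using add_nonneg h3 h4

lemma sim_nonneg (h0 : 0 ≤ q) (h1 : q ≤ 1) (hσ : IsStrategy σ) (l : List (S × A)) (n : ℕ)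
    {F : List (S × A) → ℝ} (hF : 0 ≤ F) : 0 ≤ sim q σ l n F := by
  induction l generalizing n F with
  | nil => cases n with
    | zero => exact hF []
    | succ n => exact le_rfl
  | cons p l ih => cases n with
    | zero => exact le_rfl
    | succ n =>
      exact mul_nonneg h0 (idle_nonneg h1 hσ _ (fun n F hF => ih n hF) n
        (act_nonneg hσ _ _ hF))

lemma idle_succ_one (hσ : IsStrategy σ) (s : S)
    (μ : ℕ → (List (S × A) → ℝ) →ₗ[ℝ] ℝ) (n : ℕ) :
    idle q σ s μ (n + 1) 1 = μ (n + 1) 1 + (1 - q) * idle q σ s μ n 1 := by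
  simp only [idle, LinearMap.add_apply, LinearMap.smul_apply, LinearMap.comp_apply,
    LinearMap.sum_apply, sum_act_one hσ, smul_eq_mul]

lemma summable_idle (h0 : 0 < q) (h1 : q ≤ 1) (hσ : IsStrategy σ) (s : S)
    {μ : ℕ → (List (S × A) → ℝ) →ₗ[ℝ] ℝ} (hμ : ∀ n F, 0 ≤ F → 0 ≤ μ n F)
    (hs : Summable fun n => μ n 1) : Summable fun n => idle q σ s μ n 1 := by
  have hn : ∀ n, 0 ≤ idle q σ s μ n 1 := fun n =>
    idle_nonneg h1 hσ s hμ n (fun _ => zero_le_one)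
  refine summable_of_sum_range_le (c := (∑' n, μ n 1) / q) hn fun n => ?_
  have hp : ∀ n, ∑ i ∈ Finset.range (n + 1), idle q σ s μ i 1 =
      ∑ i ∈ Finset.range (n + 1), μ i 1 + (1 - q) * ∑ i ∈ Finset.range n, idle q σ s μ i 1 := by
    intro n
    rw [Finset.sum_range_succ', Finset.sum_range_succ' (fun i => μ i 1)]
    simp only [idle_succ_one hσ, Finset.sum_add_distrib, Finset.mul_sum]
    simp only [idle]
    ring
  have h2 : ∑ i ∈ Finset.range (n + 1), μ i 1 ≤ ∑' n, μ n 1 :=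
    hs.sum_le_tsum _ fun i _ => hμ i 1 fun _ => zero_le_one
  have h3 := hp n
  rw [Finset.sum_range_succ] at h3
  rw [le_div_iff₀ h0]
  linarith [hn n]

lemma mul_tsum_idle (h0 : 0 < q) (h1 : q ≤ 1) (hσ : IsStrategy σ) (s : S)
    {μ : ℕ → (List (S × A) → ℝ) →ₗ[ℝ] ℝ} (hμ : ∀ n F, 0 ≤ F → 0 ≤ μ n F)
    (hs : Summable fun n => μ n 1) : q * ∑' n, idle q σ s μ n 1 = ∑' n, μ n 1 := by
  have hi := summable_idle h0 h1 hσ s hμ hs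
  have e := hi.tsum_eq_zero_add
  simp only [idle_succ_one hσ] at e
  rw [Summable.tsum_add ((summable_nat_add_iff 1).2 hs) (hi.mul_left _), tsum_mul_left] at e
  have e2 := hs.tsum_eq_zero_add
  simp only [idle] at e
  linarith

lemma summable_sim (h0 : 0 < q) (h1 : q ≤ 1) (hσ : IsStrategy σ) (l : List (S × A)) :
    Summable fun n => sim q σ l n 1 := by
  induction l with
  | nil =>
    refine summable_of_ne_finset_zero (s := {0}) fun n hn => ?_
    cases n with
    | zero => simp at hn
    | succ n => rfl
  | cons p l ih =>
    rw [← summable_nat_add_iff 1]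
    have hμ : ∀ n F, 0 ≤ F → 0 ≤ sim q σ l n F := fun n F hF => sim_nonneg h0.le h1 hσ l n hF
    refine Summable.mul_left q (Summable.of_nonneg_of_le
      (fun n => idle_nonneg h1 hσ _ hμ n (act_nonneg hσ _ _ fun _ => zero_le_one))
      (fun n => ?_) (summable_idle h0 h1 hσ p.1 hμ ih))
    rw [← sub_nonneg, LinearMap.comp_apply, ← map_sub]
    refine idle_nonneg h1 hσ _ hμ n fun ξ => ?_
    have : σ (ξ, p.1) p.2 ≤ ∑ a, σ (ξ, p.1) a :=
      Finset.single_le_sum (fun a _ => hσ.1 _ a) (Finset.mem_univ _)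
    rw [hσ.2] at this
    simpa [act] using this

lemma simMass_nonneg (h0 : 0 ≤ q) (h1 : q ≤ 1) (hσ : IsStrategy σ) (l : List (S × A)) :
    0 ≤ simMass q σ l :=
  tsum_nonneg fun n => sim_nonneg h0 h1 hσ l n fun _ => zero_le_one

lemma simMass_nil : simMass q σ ([] : List (S × A)) = 1 := by
  rw [simMass, tsum_eq_single 0]
  · rfl
  · intro n hn
    cases n with
    | zero => exact absurd rfl hn
    | succ n => rfl

lemma hasSum_sim_cons (h0 : 0 < q) (h1 : q ≤ 1) (hσ : IsStrategy σ) (p : S × A)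
    (l : List (S × A)) :
    HasSum (fun n => sim q σ (p :: l) (n + 1) 1) (simMass q σ (p :: l)) := by
  have := (summable_sim h0 h1 hσ (p :: l)).hasSum
  rw [← hasSum_nat_add_iff' 1] at this
  simpa [sim, simMass] using this

lemma sum_simMass_cons (h0 : 0 < q) (h1 : q ≤ 1) (hσ : IsStrategy σ) (s : S)
    (l : List (S × A)) : ∑ a, simMass q σ ((s, a) :: l) = simMass q σ l := by
  have hμ : ∀ n F, 0 ≤ F → 0 ≤ sim q σ l n F := fun n F hF => sim_nonneg h0.le h1 hσ l n hF
  have h := hasSum_sum fun (a : A) (_ : a ∈ Finset.univ) => hasSum_sim_cons h0 h1 hσ (s, a) l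
  rw [← h.tsum_eq, simMass, ← mul_tsum_idle h0 h1 hσ s hμ (summable_sim h0 h1 hσ l),
    ← tsum_mul_left]
  congr 1
  ext n
  simp only [sim, LinearMap.smul_apply, LinearMap.comp_apply, smul_eq_mul]
  rw [← Finset.mul_sum, ← map_sum, sum_act_one hσ]

lemma simMass_mul_simStrategy (h0 : 0 < q) (h1 : q ≤ 1) (hσ : IsStrategy σ) (s : S) (a : A)
    (l : List (S × A)) :
    simMass q σ l * simStrategy q σ (l, s) a = simMass q σ ((s, a) :: l) := by
  unfold simStrategy
  split_ifs with h
  · have h2 := sum_simMass_cons h0 h1 hσ s l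
    simp only at h
    rw [h, Finset.sum_eq_zero_iff_of_nonneg fun a _ => simMass_nonneg h0.le h1 hσ _] at h2
    rw [h, h2 a (Finset.mem_univ a), zero_mul]
  · exact mul_div_cancel₀ _ h

lemma isStrategy_simStrategy (h0 : 0 < q) (h1 : q ≤ 1) (hσ : IsStrategy σ) :
    IsStrategy (simStrategy q σ) := by
  constructor
  · intro η a
    unfold simStrategy
    split_ifs with h
    · exact hσ.1 η a
    · exact div_nonneg (simMass_nonneg h0.le h1 hσ _) (simMass_nonneg h0.le h1 hσ _)
  · intro η
    by_cases h : simMass q σ η.1 = 0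
    · simp [simStrategy, h, hσ.2]
    · simp only [simStrategy, h, if_false]
      rw [← Finset.sum_div, sum_simMass_cons h0 h1 hσ, div_self h]

end Memory

section Joint

variable {Ω A S : Type*}

/-- The observable past of a reversed trajectory. -/
def past (M : POMDP Ω A S) (l : List (Ω × A)) : List (S × A) := l.map fun p => (M.f p.1, p.2)

/-- The law of the state which follows a reversed trajectory. -/
def arrive (M : POMDP Ω A S) : List (Ω × A) → Ω → ℝ
  | [], ω => M.p1 ω
  | (ω', a') :: _, ω => M.P ω' a' ω

/-- The contribution of the transitions to the probability of a reversed trajectory. -/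
def natP (M : POMDP Ω A S) : List (Ω × A) → ℝ
  | [] => 1
  | (ω, _) :: l => arrive M l ω * natP M l

/-- The payoff of the most recent stage of a reversed trajectory. -/
def headPay (k : Ω → A → ℝ) : List (Ω × A) → ℝ
  | [] => 0
  | (ω, a) :: _ => k ω a

lemma trajP_cons (M : POMDP Ω A S) (σ : Strategy S A) (ω : Ω) (a : A) (l : List (Ω × A)) :
    M.trajP σ ((ω, a) :: l) = M.arrive l ω * σ (M.past l, M.f ω) a * M.trajP σ l := by
  cases l <;> rfl

lemma IsValid.arrive_nonneg [Fintype Ω] {M : POMDP Ω A S} (hM : M.IsValid)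
    (l : List (Ω × A)) (ω : Ω) : 0 ≤ M.arrive l ω := by
  cases l with
  | nil => exact hM.2.2.1 ω
  | cons p l => exact hM.1 _ _ _

lemma IsValid.natP_nonneg [Fintype Ω] {M : POMDP Ω A S} (hM : M.IsValid) (l : List (Ω × A)) :
    0 ≤ M.natP l := by
  induction l with
  | nil => exact zero_le_one
  | cons p l ih => exact mul_nonneg (hM.arrive_nonneg l _) ih

lemma IsValid.dur [Fintype Ω] [DecidableEq Ω] {M : POMDP Ω A S} (hM : M.IsValid) {h : ℝ}
    (h0 : 0 ≤ h) (h1 : h ≤ 1) : (M.dur h).IsValid := by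
  refine ⟨fun ω a ω' => ?_, fun ω a => ?_, hM.2.2⟩
  · have := hM.1 ω a ω'
    have : 0 ≤ 1 - h := sub_nonneg.2 h1
    simp only [POMDP.dur]
    split_ifs <;> positivity
  · simp [POMDP.dur, Finset.sum_add_distrib, ← Finset.mul_sum, hM.2.1]

lemma dur_dur [DecidableEq Ω] (M : POMDP Ω A S) (h q : ℝ) : (M.dur h).dur q = M.dur (q * h) := by
  simp only [POMDP.dur, POMDP.mk.injEq, true_and, and_true]
  ext ω a ω'
  ring

variable [Fintype A]

lemma trajP_simStrategy {q : ℝ} (h0 : 0 < q) (h1 : q ≤ 1) {σ : Strategy S A}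
    (hσ : IsStrategy σ) (M : POMDP Ω A S) (l : List (Ω × A)) :
    M.trajP (simStrategy q σ) l = M.natP l * simMass q σ (M.past l) := by
  induction l with
  | nil => simp [trajP, natP, past, simMass_nil]
  | cons p l ih =>
    obtain ⟨ω, a⟩ := p
    rw [trajP_cons, ih]
    have := simMass_mul_simStrategy h0 h1 hσ (M.f ω) a (M.past l)
    change _ = M.arrive l ω * M.natP l * simMass q σ ((M.f ω, a) :: M.past l)
    rw [← this]
    ring

/-- The expected payoff `k` at the current stage, as a test function. -/
def pay (M : POMDP Ω A S) (σ : Strategy S A) (k : Ω → A → ℝ) (ω : Ω) : List (S × A) → ℝ :=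
  ∑ a, k ω a • act σ (M.f ω) a 1

lemma pay_apply (M : POMDP Ω A S) (σ : Strategy S A) (k : Ω → A → ℝ) (ω : Ω)
    (ξ : List (S × A)) : M.pay σ k ω ξ = ∑ a, k ω a * σ (ξ, M.f ω) a := by
  simp [pay, act]

lemma pay_one (M : POMDP Ω A S) {σ : Strategy S A} (hσ : IsStrategy σ) :
    M.pay σ (fun _ _ => 1) = 1 := by
  ext ω ξ
  simp [pay_apply, hσ.2]

lemma abs_pay_le (M : POMDP Ω A S) {σ : Strategy S A} (hσ : IsStrategy σ) {C : ℝ}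
    {k : Ω → A → ℝ} (hk : ∀ ω a, |k ω a| ≤ C) (ω : Ω) (ξ : List (S × A)) :
    |M.pay σ k ω ξ| ≤ C := by
  rw [pay_apply]
  refine (Finset.abs_sum_le_sum_abs _ _).trans ?_
  calc ∑ a, |k ω a * σ (ξ, M.f ω) a| ≤ ∑ a, C * σ (ξ, M.f ω) a := by
        refine Finset.sum_le_sum fun a _ => ?_
        rw [abs_mul, abs_of_nonneg (hσ.1 _ a)]
        exact mul_le_mul_of_nonneg_right (hk ω a) (hσ.1 _ a)
    _ = C := by rw [← Finset.mul_sum, hσ.2, mul_one]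

variable [Fintype Ω]

/-- One step backwards: the test function on the current stage induced by the test function `F`
on the next stage, under the transitions `P`. -/
def push (M : POMDP Ω A S) (σ : Strategy S A) (P : Ω → A → Ω → ℝ)
    (F : Ω → List (S × A) → ℝ) (ω : Ω) : List (S × A) → ℝ :=
  ∑ a, act σ (M.f ω) a (∑ ω', P ω a ω' • F ω')

lemma push_apply (M : POMDP Ω A S) (σ : Strategy S A) (P : Ω → A → Ω → ℝ)
    (F : Ω → List (S × A) → ℝ) (ω : Ω) (ξ : List (S × A)) :
    M.push σ P F ω ξ = ∑ a, σ (ξ, M.f ω) a * ∑ ω', P ω a ω' * F ω' ((M.f ω, a) :: ξ) := by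
  simp [push, act, Finset.mul_sum, mul_left_comm]

lemma push_one (M : POMDP Ω A S) {σ : Strategy S A} (hσ : IsStrategy σ) {P : Ω → A → Ω → ℝ}
    (hP : ∀ ω a, ∑ ω', P ω a ω' = 1) : M.push σ P 1 = 1 := by
  ext ω ξ
  simp [push_apply, hP, hσ.2]

/-- The expectation of `F` (a function of the state and of the observable past) at stage
`n + 1`. -/
def law (M : POMDP Ω A S) (σ : Strategy S A) (n : ℕ) (F : Ω → List (S × A) → ℝ) : ℝ :=
  listSum n fun l => M.trajP σ l * ∑ ω, M.arrive l ω * F ω (M.past l)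

/-- The expectation of `F` at stage `n + 1` of the simulated game, restricted to the event that
exactly `j` of the first `n` stages are active. -/
def joint (M : POMDP Ω A S) (q : ℝ) (σ : Strategy S A) (n j : ℕ)
    (F : Ω → List (S × A) → ℝ) : ℝ :=
  listSum j fun l => M.natP l *
    ∑ ω, M.arrive l ω * idle q σ (M.f ω) (sim q σ (M.past l)) n (F ω)

lemma law_succ (M : POMDP Ω A S) (σ : Strategy S A) (n : ℕ) (F : Ω → List (S × A) → ℝ) :
    M.law σ (n + 1) F = M.law σ n (M.push σ M.P F) := by
  unfold law
  rw [listSum_succ, ← listSum_sum]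
  congr 1
  ext l
  simp only [Fintype.sum_prod_type, push_apply, trajP_cons, Finset.mul_sum, arrive]
  refine Finset.sum_congr rfl fun ω _ => Finset.sum_congr rfl fun a _ =>
    Finset.sum_congr rfl fun ω' _ => ?_
  simp only [past, List.map_cons]
  ring

lemma law_pay (M : POMDP Ω A S) (σ : Strategy S A) (n : ℕ) (k : Ω → A → ℝ) :
    M.law σ n (M.pay σ k) = listSum (n + 1) fun l => M.trajP σ l * headPay k l := by
  unfold law
  rw [listSum_succ, ← listSum_sum]
  congr 1
  ext l
  simp only [Fintype.sum_prod_type, pay_apply, trajP_cons, Finset.mul_sum, headPay]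
  refine Finset.sum_congr rfl fun ω _ => Finset.sum_congr rfl fun a _ => ?_
  ring

lemma stageE_eq_law (M : POMDP Ω A S) (σ : Strategy S A) (n : ℕ) :
    M.stageE σ n = M.law σ n (M.pay σ M.g) := by
  rw [law_pay]
  simp [stageE, listSum, List.ofFn_succ, headPay]

lemma law_add (M : POMDP Ω A S) (σ : Strategy S A) (n : ℕ) (F G : Ω → List (S × A) → ℝ) :
    M.law σ n (F + G) = M.law σ n F + M.law σ n G := by
  unfold law
  rw [← listSum_add]
  simp only [Pi.add_apply, mul_add, Finset.sum_add_distrib]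

lemma law_smul (M : POMDP Ω A S) (σ : Strategy S A) (n : ℕ) (c : ℝ)
    (F : Ω → List (S × A) → ℝ) : M.law σ n (c • F) = c * M.law σ n F := by
  unfold law
  rw [← listSum_mul_left]
  simp only [Pi.smul_apply, smul_eq_mul, mul_left_comm, Finset.mul_sum]

lemma joint_add (M : POMDP Ω A S) (q : ℝ) (σ : Strategy S A) (n j : ℕ)
    (F G : Ω → List (S × A) → ℝ) :
    M.joint q σ n j (F + G) = M.joint q σ n j F + M.joint q σ n j G := by
  unfold joint
  rw [← listSum_add]
  simp only [Pi.add_apply, map_add, mul_add, Finset.sum_add_distrib]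

lemma joint_smul (M : POMDP Ω A S) (q : ℝ) (σ : Strategy S A) (n j : ℕ) (c : ℝ)
    (F : Ω → List (S × A) → ℝ) : M.joint q σ n j (c • F) = c * M.joint q σ n j F := by
  unfold joint
  rw [← listSum_mul_left]
  simp only [Pi.smul_apply, map_smul, smul_eq_mul, mul_left_comm, Finset.mul_sum]

lemma IsValid.trajP_nonneg {M : POMDP Ω A S} (hM : M.IsValid) {σ : Strategy S A}
    (hσ : IsStrategy σ) (l : List (Ω × A)) : 0 ≤ M.trajP σ l := by
  induction l with
  | nil => exact zero_le_one
  | cons p l ih =>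
    rw [trajP_cons]
    exact mul_nonneg (mul_nonneg (hM.arrive_nonneg l _) (hσ.1 _ _)) ih

lemma IsValid.law_one {M : POMDP Ω A S} (hM : M.IsValid) {σ : Strategy S A}
    (hσ : IsStrategy σ) (n : ℕ) : M.law σ n 1 = 1 := by
  induction n with
  | zero => simp [law, listSum_zero, trajP, arrive, hM.2.2.2]
  | succ n ih => rw [law_succ, push_one M hσ hM.2.1, ih]

lemma IsValid.law_nonneg {M : POMDP Ω A S} (hM : M.IsValid) {σ : Strategy S A}
    (hσ : IsStrategy σ) (n : ℕ) {F : Ω → List (S × A) → ℝ} (hF : ∀ ω ξ, 0 ≤ F ω ξ) :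
    0 ≤ M.law σ n F :=
  listSum_nonneg fun l => mul_nonneg (hM.trajP_nonneg hσ l) <|
    Finset.sum_nonneg fun _ _ => mul_nonneg (hM.arrive_nonneg _ _) (hF _ _)

lemma IsValid.joint_nonneg {M : POMDP Ω A S} (hM : M.IsValid) {q : ℝ} (h0 : 0 ≤ q)
    (h1 : q ≤ 1) {σ : Strategy S A} (hσ : IsStrategy σ) (n j : ℕ)
    {F : Ω → List (S × A) → ℝ} (hF : ∀ ω ξ, 0 ≤ F ω ξ) : 0 ≤ M.joint q σ n j F :=
  listSum_nonneg fun l => mul_nonneg (hM.natP_nonneg l) <|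
    Finset.sum_nonneg fun ω _ => mul_nonneg (hM.arrive_nonneg _ _) <|
      idle_nonneg h1 hσ _ (fun n _ hF => sim_nonneg h0 h1 hσ _ n hF) n (hF ω)

lemma IsValid.abs_law_le {M : POMDP Ω A S} (hM : M.IsValid) {σ : Strategy S A}
    (hσ : IsStrategy σ) (n : ℕ) {F : Ω → List (S × A) → ℝ} {C : ℝ}
    (hF : ∀ ω ξ, |F ω ξ| ≤ C) : |M.law σ n F| ≤ C := by
  have e1 := hM.law_nonneg hσ n (F := C • 1 + F) fun ω ξ => by
    simpa using neg_le_iff_add_nonneg'.1 (abs_le.1 (hF ω ξ)).1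
  have e2 := hM.law_nonneg hσ n (F := C • 1 + (-1 : ℝ) • F) fun ω ξ => by
    simpa using (abs_le.1 (hF ω ξ)).2
  rw [law_add, law_smul, hM.law_one hσ] at e1 e2
  rw [law_smul] at e2
  exact abs_le.2 ⟨by linarith, by linarith⟩

lemma IsValid.abs_joint_le {M : POMDP Ω A S} (hM : M.IsValid) {q : ℝ} (h0 : 0 ≤ q)
    (h1 : q ≤ 1) {σ : Strategy S A} (hσ : IsStrategy σ) (n j : ℕ)
    {F : Ω → List (S × A) → ℝ} {C : ℝ} (hF : ∀ ω ξ, |F ω ξ| ≤ C) :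
    |M.joint q σ n j F| ≤ C * M.joint q σ n j 1 := by
  have e1 := hM.joint_nonneg h0 h1 hσ n j (F := C • 1 + F) fun ω ξ => by
    simpa using neg_le_iff_add_nonneg'.1 (abs_le.1 (hF ω ξ)).1
  have e2 := hM.joint_nonneg h0 h1 hσ n j (F := C • 1 + (-1 : ℝ) • F) fun ω ξ => by
    simpa using (abs_le.1 (hF ω ξ)).2
  rw [joint_add, joint_smul] at e1 e2
  rw [joint_smul] at e2
  exact abs_le.2 ⟨by linarith, by linarith⟩

lemma hasSum_joint_pay (M : POMDP Ω A S) {q : ℝ} (h0 : 0 < q) (h1 : q ≤ 1)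
    {σ : Strategy S A} (hσ : IsStrategy σ) (j : ℕ) (k : Ω → A → ℝ) :
    HasSum (fun n => q * M.joint q σ n j (M.pay σ k))
      (M.law (simStrategy q σ) j (M.pay (simStrategy q σ) k)) := by
  have e : ∀ n, q * M.joint q σ n j (M.pay σ k) = listSum (j + 1) fun l =>
      M.natP l * headPay k l * (match l with
        | [] => 0
        | p :: l => sim q σ ((M.f p.1, p.2) :: M.past l) (n + 1) 1) := by
    intro n
    unfold joint
    rw [listSum_succ, ← listSum_sum, ← listSum_mul_left]
    congr 1
    ext l
    simp only [Fintype.sum_prod_type, pay, map_sum, map_smul, Finset.mul_sum, headPay, natP,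
      sim, LinearMap.smul_apply, LinearMap.comp_apply, smul_eq_mul]
    refine Finset.sum_congr rfl fun ω _ => Finset.sum_congr rfl fun a _ => ?_
    ring
  rw [law_pay]
  simp only [e]
  refine hasSum_listSum fun l => ?_
  rw [trajP_simStrategy h0 h1 hσ, mul_right_comm]
  cases l with
  | nil => simp [headPay, hasSum_zero]
  | cons p l => exact (hasSum_sim_cons h0 h1 hσ (M.f p.1, p.2) (M.past l)).mul_left _

lemma joint_zero_zero (M : POMDP Ω A S) (q : ℝ) (σ : Strategy S A)
    (F : Ω → List (S × A) → ℝ) : M.joint q σ 0 0 F = ∑ ω, M.p1 ω * F ω [] := by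
  simp [joint, listSum_zero, natP, arrive, idle, sim, past]

lemma joint_zero_succ (M : POMDP Ω A S) (q : ℝ) (σ : Strategy S A) (j : ℕ)
    (F : Ω → List (S × A) → ℝ) : M.joint q σ 0 (j + 1) F = 0 := by
  unfold joint
  rw [listSum_succ]
  simp [idle, sim, past, listSum]

variable [DecidableEq Ω]

/-- The transitions which leave the state unchanged. -/
def stay : Ω → A → Ω → ℝ := fun ω _ ω' => if ω' = ω then 1 else 0

lemma push_stay (M : POMDP Ω A S) (σ : Strategy S A) (F : Ω → List (S × A) → ℝ) (ω : Ω) :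
    M.push σ stay F ω = (∑ a, act σ (M.f ω) a) (F ω) := by
  simp [push, stay, LinearMap.sum_apply]

lemma joint_succ_zero (M : POMDP Ω A S) (q : ℝ) (σ : Strategy S A) (n : ℕ)
    (F : Ω → List (S × A) → ℝ) :
    M.joint q σ (n + 1) 0 F = (1 - q) * M.joint q σ n 0 (M.push σ stay F) := by
  simp only [joint, listSum_zero, idle, push_stay, past, List.map_nil, sim,
    LinearMap.add_apply, LinearMap.smul_apply, LinearMap.comp_apply, smul_eq_mul, Finset.mul_sum]
  refine Finset.sum_congr rfl fun ω _ => ?_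
  simp only [LinearMap.zero_apply]
  ring

lemma joint_succ_succ (M : POMDP Ω A S) (q : ℝ) (σ : Strategy S A) (n j : ℕ)
    (F : Ω → List (S × A) → ℝ) :
    M.joint q σ (n + 1) (j + 1) F = q * M.joint q σ n j (M.push σ M.P F) +
      (1 - q) * M.joint q σ n (j + 1) (M.push σ stay F) := by
  have e1 : q * M.joint q σ n j (M.push σ M.P F) = listSum (j + 1) fun l =>
      M.natP l * ∑ ω, M.arrive l ω * sim q σ (M.past l) (n + 1) (F ω) := by
    unfold joint
    rw [listSum_succ, ← listSum_sum, ← listSum_mul_left]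
    congr 1
    ext l
    simp only [Fintype.sum_prod_type, push, map_sum, map_smul, Finset.mul_sum, natP, arrive,
      past, List.map_cons, sim, LinearMap.smul_apply, LinearMap.comp_apply, smul_eq_mul]
    refine Finset.sum_congr rfl fun ω _ => Finset.sum_congr rfl fun a _ =>
      Finset.sum_congr rfl fun ω' _ => ?_
    ring
  rw [e1]
  unfold joint
  rw [← listSum_mul_left, ← listSum_add]
  congr 1
  ext l
  simp only [idle, push_stay, LinearMap.add_apply, LinearMap.smul_apply, LinearMap.comp_apply,
    smul_eq_mul, Finset.mul_sum, ← Finset.sum_add_distrib]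
  refine Finset.sum_congr rfl fun ω _ => ?_
  ring

lemma push_dur (M : POMDP Ω A S) (σ : Strategy S A) (q : ℝ) (F : Ω → List (S × A) → ℝ) :
    (M.dur q).push σ (M.dur q).P F = q • M.push σ M.P F + (1 - q) • M.push σ stay F := by
  ext ω ξ
  simp only [push_apply, Pi.add_apply, Pi.smul_apply, smul_eq_mul, dur, stay, Finset.mul_sum,
    ← Finset.sum_add_distrib]
  refine Finset.sum_congr rfl fun a _ => Finset.sum_congr rfl fun ω' _ => ?_
  ring

lemma sum_joint (M : POMDP Ω A S) (q : ℝ) (σ : Strategy S A) (n J : ℕ) (hJ : n < J)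
    (F : Ω → List (S × A) → ℝ) :
    ∑ j ∈ Finset.range J, M.joint q σ n j F = (M.dur q).law σ n F := by
  obtain ⟨J, rfl⟩ : ∃ K, J = K + 1 := ⟨J - 1, by omega⟩
  induction n generalizing J F with
  | zero =>
    rw [Finset.sum_range_succ']
    simp [joint_zero_succ, joint_zero_zero, law, listSum_zero, trajP, arrive, past, dur]
  | succ n ih =>
    obtain ⟨K, rfl⟩ : ∃ K, J = K + 1 := ⟨J - 1, by omega⟩
    rw [Finset.sum_range_succ']
    simp only [joint_succ_succ, joint_succ_zero, Finset.sum_add_distrib, ← Finset.mul_sum]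
    rw [add_assoc, ← mul_add, ← Finset.sum_range_succ' fun j =>
      M.joint q σ n j (M.push σ stay F), ih _ K (by omega), ih _ (K + 1) (by omega), law_succ,
      push_dur, law_add, law_smul, law_smul]

lemma IsValid.joint_one {M : POMDP Ω A S} (hM : M.IsValid) (q : ℝ) {σ : Strategy S A}
    (hσ : IsStrategy σ) (n j : ℕ) :
    M.joint q σ n j 1 = binom q n fun i => if i = j then 1 else 0 := by
  have hs : M.push σ stay 1 = 1 := push_one M hσ fun ω a => by simp [stay]
  induction n generalizing j with
  | zero => cases j with
    | zero => simp [joint_zero_zero, binom, hM.2.2.2]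
    | succ j => simp [joint_zero_succ, binom]
  | succ n ih => cases j with
    | zero =>
      rw [joint_succ_zero, hs, ih, ← binom_mul_left]
      simp [binom]
    | succ j =>
      rw [joint_succ_succ, hs, push_one M hσ hM.2.1, ih, ih, ← binom_mul_left, ← binom_mul_left,
        ← binom_add]
      simp [binom]

lemma IsValid.sum_joint_one {M : POMDP Ω A S} (hM : M.IsValid) (q : ℝ) {σ : Strategy S A}
    (hσ : IsStrategy σ) (n T : ℕ) : ∑ j ∈ Finset.range T, M.joint q σ n j 1 =
      binom q n fun i => if i < T then 1 else 0 := by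
  induction T with
  | zero => simp [binom_const]
  | succ T ih =>
    rw [Finset.sum_range_succ, ih, hM.joint_one q hσ, ← binom_add]
    congr 1
    ext i
    split_ifs <;> first | omega | norm_num

lemma IsValid.le_sum_stageE_simStrategy {M : POMDP Ω A S} (hM : M.IsValid) {q : ℝ}
    (h0 : 0 < q) (h1 : q ≤ 1) {σ : Strategy S A} (hσ : IsStrategy σ) {C : ℝ}
    (hC : ∀ ω a, |M.g ω a| ≤ C) (hC0 : 0 ≤ C) {N T : ℕ} (hT : N * q ≤ T) :
    q * ∑ n ∈ Finset.range N, (M.dur q).stageE σ n - C * (T - N * q + 2 * √N) ≤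
      ∑ j ∈ Finset.range T, M.stageE (simStrategy q σ) j := by
  set G : ℕ → ℕ → ℝ := fun n j => q * M.joint q σ n j (M.pay σ M.g) with hG
  set B : ℕ → ℕ → ℝ := fun n j => q * M.joint q σ n j 1 with hB
  have hτ := isStrategy_simStrategy h0 h1 hσ
  have hGB : ∀ n j, |G n j| ≤ C * B n j := by
    intro n j
    rw [hG, hB, abs_mul, abs_of_pos h0, mul_left_comm]
    exact mul_le_mul_of_nonneg_left
      (hM.abs_joint_le h0.le h1 hσ n j (M.abs_pay_le hσ hC)) h0.le
  have hBsum : ∀ j, HasSum (fun n => B n j) 1 := by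
    intro j
    have := M.hasSum_joint_pay h0 h1 hσ j fun _ _ => 1
    rwa [pay_one M hσ, pay_one M hτ, hM.law_one hτ] at this
  have hGsum : ∀ j, HasSum (fun n => G n j) (M.stageE (simStrategy q σ) j) := by
    intro j
    rw [stageE_eq_law]
    exact M.hasSum_joint_pay h0 h1 hσ j M.g
  have hGe : ∀ n J, n < J → ∑ j ∈ Finset.range J, G n j = q * (M.dur q).stageE σ n := by
    intro n J hJ
    rw [hG, ← Finset.mul_sum, sum_joint M q σ n J hJ, stageE_eq_law]
    rfl
  have hBe : ∀ n J, n < J → ∑ j ∈ Finset.range J, B n j = q := by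
    intro n J hJ
    rw [hB, ← Finset.mul_sum, sum_joint M q σ n J hJ, (hM.dur h0.le h1).law_one hσ, mul_one]
  have hY : N * q - √N ≤ ∑ n ∈ Finset.range N, ∑ j ∈ Finset.range T, B n j := by
    simp only [hB, ← Finset.mul_sum, hM.sum_joint_one q hσ]
    rw [Finset.mul_sum, sum_binom_lt]
    exact le_binom_min h0.le h1 N T hT
  have hreal : ∀ j, ∑ n ∈ Finset.range N, G n j - C * (1 - ∑ n ∈ Finset.range N, B n j) ≤
      M.stageE (simStrategy q σ) j := by
    intro j
    have := sum_le_hasSum (Finset.range N)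
      (fun n _ => neg_le_iff_add_nonneg'.1 (abs_le.1 (hGB n j)).1)
      (((hBsum j).mul_left C).add (hGsum j))
    rw [Finset.sum_add_distrib, ← Finset.mul_sum] at this
    linarith
  have hfake : ∀ n, q * (M.dur q).stageE σ n - C * (q - ∑ j ∈ Finset.range T, B n j) ≤
      ∑ j ∈ Finset.range T, G n j := by
    intro n
    have hsub : Finset.range T ⊆ Finset.range (T + n + 1) :=
      Finset.range_mono (by omega)
    have := Finset.sum_le_sum_of_subset_of_nonneg hsub
      fun j _ _ => sub_nonneg.2 (abs_le.1 (hGB n j)).2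
    simp only [Finset.sum_sub_distrib, ← Finset.mul_sum] at this
    rw [hGe n (T + n + 1) (by omega), hBe n (T + n + 1) (by omega)] at this
    linarith
  have s1 := Finset.sum_le_sum fun j (_ : j ∈ Finset.range T) => hreal j
  have s2 := Finset.sum_le_sum fun n (_ : n ∈ Finset.range N) => hfake n
  simp only [Finset.sum_sub_distrib, ← Finset.mul_sum, Finset.sum_const, Finset.card_range,
    nsmul_eq_mul, mul_one] at s1 s2
  rw [Finset.sum_comm, Finset.sum_comm (f := fun j n => B n j)] at s1
  have := mul_le_mul_of_nonneg_left hY hC0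
  linarith

end Joint

section Value

variable {Ω A S : Type*} [Fintype Ω] [Fintype A]

lemma exists_bound_g (M : POMDP Ω A S) : ∃ C, 0 ≤ C ∧ ∀ ω a, |M.g ω a| ≤ C :=
  ⟨∑ ω, ∑ a, |M.g ω a|, by positivity, fun ω a =>
    (Finset.single_le_sum (f := fun a => |M.g ω a|) (fun _ _ => abs_nonneg _)
      (Finset.mem_univ a)).trans
    (Finset.single_le_sum (f := fun ω => ∑ a, |M.g ω a|)
      (fun _ _ => Finset.sum_nonneg fun _ _ => abs_nonneg _) (Finset.mem_univ ω))⟩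

lemma IsValid.abs_average_le {M : POMDP Ω A S} (hM : M.IsValid) {σ : Strategy S A}
    (hσ : IsStrategy σ) {C : ℝ} (hC : ∀ ω a, |M.g ω a| ≤ C) (hC0 : 0 ≤ C) (T : ℕ) :
    |1 / (T : ℝ) * ∑ n ∈ Finset.range T, M.stageE σ n| ≤ C := by
  have h : |∑ n ∈ Finset.range T, M.stageE σ n| ≤ T * C := by
    refine (Finset.abs_sum_le_sum_abs _ _).trans ?_
    calc _ ≤ ∑ _n ∈ Finset.range T, C := Finset.sum_le_sum fun n _ => by
          rw [stageE_eq_law]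
          exact hM.abs_law_le hσ n (M.abs_pay_le hσ hC)
      _ = T * C := by simp
  rw [one_div, abs_mul, abs_of_nonneg (by positivity : (0 : ℝ) ≤ (T : ℝ)⁻¹)]
  rcases Nat.eq_zero_or_pos T with rfl | hT
  · simpa using hC0
  · rwa [inv_mul_le_iff₀ (by exact_mod_cast hT)]

lemma IsValid.isBoundedUnder_ge {M : POMDP Ω A S} (hM : M.IsValid) {σ : Strategy S A}
    (hσ : IsStrategy σ) : IsBoundedUnder (· ≥ ·) atTop
      fun T : ℕ => 1 / (T : ℝ) * ∑ n ∈ Finset.range T, M.stageE σ n := by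
  obtain ⟨C, hC0, hC⟩ := M.exists_bound_g
  exact isBoundedUnder_of ⟨-C, fun T => (abs_le.1 (hM.abs_average_le hσ hC hC0 T)).1⟩

lemma IsValid.isBoundedUnder_le {M : POMDP Ω A S} (hM : M.IsValid) {σ : Strategy S A}
    (hσ : IsStrategy σ) : IsBoundedUnder (· ≤ ·) atTop
      fun T : ℕ => 1 / (T : ℝ) * ∑ n ∈ Finset.range T, M.stageE σ n := by
  obtain ⟨C, hC0, hC⟩ := M.exists_bound_g
  exact isBoundedUnder_of ⟨C, fun T => (abs_le.1 (hM.abs_average_le hσ hC hC0 T)).2⟩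

lemma IsValid.abs_R_le {M : POMDP Ω A S} (hM : M.IsValid) {σ : Strategy S A}
    (hσ : IsStrategy σ) {C : ℝ} (hC : ∀ ω a, |M.g ω a| ≤ C) (hC0 : 0 ≤ C) : |M.R σ| ≤ C := by
  have h := fun T => abs_le.1 (hM.abs_average_le hσ hC hC0 T)
  exact abs_le.2
    ⟨le_liminf_of_le (hM.isBoundedUnder_le hσ).isCoboundedUnder_ge (.of_forall fun T => (h T).1),
      liminf_le_of_frequently_le (.of_forall fun T => (h T).2) (hM.isBoundedUnder_ge hσ)⟩

/-- A strategy in the game slowed down by the factor `q` guarantees no more than its simulation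
in the original game. -/
lemma IsValid.R_dur_le [DecidableEq Ω] {M : POMDP Ω A S} (hM : M.IsValid) {q : ℝ}
    (h0 : 0 < q) (h1 : q ≤ 1) {σ : Strategy S A} (hσ : IsStrategy σ) :
    (M.dur q).R σ ≤ M.R (simStrategy q σ) := by
  obtain ⟨C, hC0, hC⟩ := M.exists_bound_g
  have hτ := isStrategy_simStrategy h0 h1 hσ
  refine le_of_forall_lt fun r hr => ?_
  obtain ⟨r', hrr', hr'⟩ := exists_between hr
  refine hrr'.trans_le ?_
  have he := eventually_lt_of_lt_liminf hr' ((hM.dur h0.le h1).isBoundedUnder_ge hσ)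
  have hN : Tendsto (fun T : ℕ => ⌊(T : ℝ) / q⌋₊) atTop atTop :=
    tendsto_nat_floor_atTop.comp (tendsto_natCast_atTop_atTop.atTop_div_const h0)
  set K : ℝ := |r'| + C
  set D : ℝ := 2 * C / √q
  have hlim : Tendsto (fun T : ℕ => r' - (K / T + D / √(T : ℝ))) atTop (nhds r') := by
    have t1 : Tendsto (fun T : ℕ => K / (T : ℝ)) atTop (nhds 0) :=
      tendsto_const_nhds.div_atTop tendsto_natCast_atTop_atTop
    have t2 : Tendsto (fun T : ℕ => D / √(T : ℝ)) atTop (nhds 0) :=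
      tendsto_const_nhds.div_atTop
        (Real.tendsto_sqrt_atTop.comp tendsto_natCast_atTop_atTop)
    simpa using (t1.add t2).const_sub r'
  have hle : ∀ᶠ T : ℕ in atTop, r' - (K / T + D / √(T : ℝ)) ≤
      1 / (T : ℝ) * ∑ n ∈ Finset.range T, M.stageE (simStrategy q σ) n := by
    filter_upwards [hN.eventually he, hN.eventually_gt_atTop 0, eventually_gt_atTop 0]
      with T hT hNT hT0
    set N := ⌊(T : ℝ) / q⌋₊
    have hTpos : (0 : ℝ) < T := by exact_mod_cast hT0
    have hNpos : (0 : ℝ) < N := by exact_mod_cast hNT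
    have hNle : N ≤ T / q := Nat.floor_le (by positivity)
    have hNq : N * q ≤ T := (le_div_iff₀ h0).1 hNle
    have hNlt : T < (N + 1) * q := (div_lt_iff₀ h0).1 (Nat.lt_floor_add_one _)
    have hmain := hM.le_sum_stageE_simStrategy h0 h1 hσ hC hC0 hNq
    rw [one_div, ← div_eq_inv_mul, lt_div_iff₀ hNpos] at hT
    have hsqrt : √(N : ℝ) ≤ √T / √q := by
      rw [← Real.sqrt_div hTpos.le]
      exact Real.sqrt_le_sqrt hNle
    have e1 : r' * (T - N * q) ≤ |r'| := by
      calc r' * (T - N * q) ≤ |r'| * (T - N * q) :=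
            mul_le_mul_of_nonneg_right (le_abs_self _) (by linarith)
        _ ≤ |r'| * 1 := mul_le_mul_of_nonneg_left (by nlinarith) (abs_nonneg _)
        _ = |r'| := mul_one _
    have e2 : C * (T - N * q + 2 * √N) ≤ C * (1 + 2 * (√T / √q)) :=
      mul_le_mul_of_nonneg_left (by nlinarith) hC0
    have e3 : q * (r' * N) ≤ q * ∑ n ∈ Finset.range N, (M.dur q).stageE σ n :=
      mul_le_mul_of_nonneg_left hT.le h0.le
    have e4 : (r' - (K / T + D / √(T : ℝ))) * T = r' * T - |r'| - C * (1 + 2 * (√T / √q)) := by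
      have : D / √(T : ℝ) * T = D * √T := by
        rw [div_mul_eq_mul_div, mul_div_assoc, Real.div_sqrt]
      rw [sub_mul, add_mul, this, div_mul_cancel₀ _ hTpos.ne']
      simp only [K, D]
      ring
    rw [one_div, ← div_eq_inv_mul, le_div_iff₀ hTpos, e4]
    linarith
  calc r' = liminf (fun T : ℕ => r' - (K / T + D / √(T : ℝ))) atTop := hlim.liminf_eq.symm
    _ ≤ _ := liminf_le_liminf hle hlim.isBoundedUnder_ge
        (hM.isBoundedUnder_le hτ).isCoboundedUnder_ge

lemma IsValid.monotoneOn_V [DecidableEq Ω] {M : POMDP Ω A S} (hM : M.IsValid) :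
    MonotoneOn M.V (Set.Ioc 0 1) := by
  intro h hh h' hh' hle
  rcases isEmpty_or_nonempty {σ : Strategy S A // IsStrategy σ} with hE | ⟨σ₀, hσ₀⟩
  · have : ∀ x, M.V x = 0 := fun x => by
      rw [V, show {r | ∃ σ : Strategy S A, IsStrategy σ ∧ r = (M.dur x).R σ} = ∅ from
        Set.eq_empty_of_forall_notMem fun r ⟨σ, hσ, _⟩ => hE.false ⟨σ, hσ⟩, Real.sSup_empty]
    rw [this, this]
  obtain ⟨C, hC0, hC⟩ := M.exists_bound_g
  refine csSup_le ⟨_, σ₀, hσ₀, rfl⟩ ?_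
  rintro r ⟨σ, hσ, rfl⟩
  have hq0 : 0 < h / h' := div_pos hh.1 hh'.1
  have hq1 : h / h' ≤ 1 := (div_le_one hh'.1).2 hle
  have hM' := hM.dur hh'.1.le hh'.2
  have key := hM'.R_dur_le hq0 hq1 hσ
  rw [dur_dur, div_mul_cancel₀ _ hh'.1.ne'] at key
  refine key.trans (le_csSup ⟨C, ?_⟩ ⟨_, isStrategy_simStrategy hq0 hq1 hσ, rfl⟩)
  rintro _ ⟨τ, hτ, rfl⟩
  exact (abs_le.1 (hM'.abs_R_le hτ hC hC0)).2

lemma IsValid.neg_le_V [DecidableEq Ω] {M : POMDP Ω A S} (hM : M.IsValid) {C : ℝ}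
    (hC : ∀ ω a, |M.g ω a| ≤ C) (hC0 : 0 ≤ C) {h : ℝ} (h0 : 0 ≤ h) (h1 : h ≤ 1) :
    -C ≤ M.V h := by
  have hR := fun σ (hσ : IsStrategy σ) => abs_le.1 ((hM.dur h0 h1).abs_R_le hσ hC hC0)
  rcases Set.eq_empty_or_nonempty {r | ∃ σ : Strategy S A, IsStrategy σ ∧ r = (M.dur h).R σ}
    with hE | ⟨r, σ, hσ, rfl⟩
  · rw [V, hE, Real.sSup_empty]
    linarith
  · refine (hR σ hσ).1.trans (le_csSup ⟨C, ?_⟩ ⟨σ, hσ, rfl⟩)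
    rintro _ ⟨τ, hτ, rfl⟩
    exact (hR τ hτ).2

end Value

end POMDP

/-- The limit `lim_{h→0⁺} V(h)` exists and is finite. -/
theorem value_limit_exists {Ω A S : Type*} [Fintype Ω] [Fintype A] [DecidableEq Ω]
    (M : POMDP Ω A S) (hM : M.IsValid) :
    ∃ L : ℝ, Tendsto M.V (nhdsWithin 0 (Set.Ioc (0 : ℝ) 1)) (nhds L) := by
  obtain ⟨C, hC0, hC⟩ := M.exists_bound_g
  have hbdd : BddBelow (M.V '' Set.Ioo (0 : ℝ) 1) := by
    refine ⟨-C, ?_⟩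
    rintro _ ⟨h, hh, rfl⟩
    exact hM.neg_le_V hC hC0 hh.1.le hh.2.le
  rw [nhdsWithin_Ioc_eq_nhdsGT zero_lt_one]
  exact ⟨_, (hM.monotoneOn_V.mono Set.Ioo_subset_Ioc_self).tendsto_nhdsWithin_Ioo_right
    (Set.nonempty_Ioo.2 zero_lt_one) hbdd⟩
end

section
/- Let h ∈ (0,1), let σ be a behavior strategy in G_h, and let σ̂ be the mimicking strategy in G_1 defined by σ̂(η_k)(â) = P^h_σ(a'_{T_k} = â | H^fil_k = η_k) (with an arbitrary fixed mixed action when P^h_σ(H^fil_k = η_k) = 0). Then for every k ≥ 1, E^1_{σ̂}[g(ω_k, a_k)] = E^h_σ[g(ω'_{T_k}, a'_{T_k})], where (ω_k, a_k) are the stage-k state and action in G_1 under σ̂ and (ω'_j, a'_j) are the stage-j state and action in G_h under σ. -/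
open Filter

namespace POMDP

variable {Ω A S : Type*} [Fintype Ω] [Fintype A]

/-- Observable history determined by a reversed past extended trajectory
(with coin flips) and the current state. -/
def obsE (M : POMDP Ω A S) (rev : List (Ω × A × Bool)) (ω : Ω) : Hist S A :=
  (rev.map fun p => (M.f p.1, p.2.1), M.f ω)

/-- Probability of a finite extended trajectory in `G_h` under `σ`, given in
reverse order: each stage records the state, the action, and the coin `X_i`
deciding whether the transition at the end of the stage is governed by `P`
(`true`, probability `h`) or the state is frozen (`false`, probability `1-h`). -/
def etrajP [DecidableEq Ω] (M : POMDP Ω A S) (h : ℝ) (σ : Strategy S A) :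
    List (Ω × A × Bool) → ℝ
  | [] => 1
  | (ω, a, x) :: rest =>
      (match rest with
        | [] => M.p1 ω
        | (ω', a', x') :: _ =>
            if x' then M.P ω' a' ω else if ω = ω' then 1 else 0) *
        σ (M.obsE rest ω) a * (if x then h else 1 - h) * etrajP M h σ rest

variable [DecidableEq Ω]

/-- Probability of a forward extended trajectory `tr` (stage 1 first). -/
noncomputable def eP (M : POMDP Ω A S) (h : ℝ) (σ : Strategy S A) {n : ℕ}
    (tr : Fin n → Ω × A × Bool) : ℝ :=
  etrajP M h σ (List.ofFn tr).reverse

/-- `E^h_σ[g(ω'_{T_k}, a'_{T_k})]`, decomposed over the value `n+1` of `T_k`: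
`T_k = n+1` iff the last coin is `true` and there are exactly `k` `true` coins. -/
noncomputable def ETk (M : POMDP Ω A S) (h : ℝ) (σ : Strategy S A) (k : ℕ) : ℝ :=
  ∑' n : ℕ, ∑ tr : Fin (n + 1) → Ω × A × Bool,
    if (tr (Fin.last n)).2.2 = true ∧ (List.ofFn tr).countP (fun p => p.2.2) = k then
      eP M h σ tr * M.g (tr (Fin.last n)).1 (tr (Fin.last n)).2.1
    else 0

end POMDP

namespace POMDP

variable {Ω A S : Type*} [Fintype Ω] [Fintype A]

/-- Auxiliary computation of the filtered history along a *forward* extended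
trajectory: `acc` is the reversed list of (signal, action) pairs recorded so far
and `s` is the current pending signal. At a stage whose coin is `true` (and which
is not the last stage of the trajectory), the pair `(s, action)` is recorded and
the pending signal becomes the signal of the state of the next stage. -/
def filAux (f : Ω → S) : List (S × A) → S → List (Ω × A × Bool) → Hist S A
  | acc, s, [] => (acc, s)
  | acc, s, (_, a, x) :: rest =>
      if x then
        match rest with
        | [] => (acc, s)
        | (ω', _, _) :: _ => filAux f ((s, a) :: acc) (f ω') rest
      else filAux f acc s rest

/-- The filtered history `H^fil_k = (s'_1, a'_{T_1}, s'_{T_1+1}, …, a'_{T_{k-1}},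
s'_{T_{k-1}+1})` of a forward extended trajectory whose length is `T_k`. -/
def filHist (M : POMDP Ω A S) {n : ℕ} (tr : Fin (n + 1) → Ω × A × Bool) : Hist S A :=
  filAux M.f [] (M.f (tr 0).1) (List.ofFn tr)

variable [DecidableEq Ω] [DecidableEq A] [DecidableEq S]

/-- `P^h_σ(H^fil_k = η, ω'_{T_k} = ω, a'_{T_k} = a)`, decomposed over the value
`n+1` of `T_k` (the event entails `T_k < ∞`). -/
noncomputable def jointFil (M : POMDP Ω A S) (h : ℝ) (σ : Strategy S A) (k : ℕ)
    (η : Hist S A) (ω : Ω) (a : A) : ℝ :=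
  ∑' n : ℕ, ∑ tr : Fin (n + 1) → Ω × A × Bool,
    if (tr (Fin.last n)).2.2 = true ∧ (List.ofFn tr).countP (fun p => p.2.2) = k ∧
        filHist M tr = η ∧ (tr (Fin.last n)).1 = ω ∧ (tr (Fin.last n)).2.1 = a then
      eP M h σ tr
    else 0

/-- `P^h_σ(H^fil_k = η, a'_{T_k} = a)`. -/
noncomputable def jointFilA (M : POMDP Ω A S) (h : ℝ) (σ : Strategy S A) (k : ℕ)
    (η : Hist S A) (a : A) : ℝ :=
  ∑ ω : Ω, jointFil M h σ k η ω a

/-- `P^h_σ(H^fil_k = η)` (the event `T_k = ∞` being null). -/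
noncomputable def probFil (M : POMDP Ω A S) (h : ℝ) (σ : Strategy S A) (k : ℕ)
    (η : Hist S A) : ℝ :=
  ∑ a : A, jointFilA M h σ k η a

/-- The mimicking strategy `σ̂` in `G₁`: at a history `η` of length `k`
(`k = η.1.length + 1`), it plays the conditional law of `a'_{T_k}` given
`H^fil_k = η`; if the conditioning event is null it plays the fixed mixed
action `ρ`. -/
noncomputable def mimic (M : POMDP Ω A S) (h : ℝ) (σ : Strategy S A) (ρ : A → ℝ) :
    Strategy S A := fun η a =>
  if probFil M h σ (η.1.length + 1) η = 0 then ρ a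
  else jointFilA M h σ (η.1.length + 1) η a / probFil M h σ (η.1.length + 1) η

end POMDP

/-- The sum of `F` over all lists of length `n`. -/
def sumLists {X : Type*} [Fintype X] (n : ℕ) (F : List X → ℝ) : ℝ :=
  ∑ v : Fin n → X, F (List.ofFn v)

section SumLists

variable {X : Type*} [Fintype X]

lemma sumLists_zero (F : List X → ℝ) : sumLists 0 F = F [] := by
  simp [sumLists]

lemma sumLists_succ (n : ℕ) (F : List X → ℝ) :
    sumLists (n + 1) F = ∑ x, sumLists n fun l => F (x :: l) := by
  unfold sumLists
  rw [← Fintype.sum_prod_type' (f := fun x (v : Fin n → X) => F (x :: List.ofFn v))]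
  exact (Fintype.sum_equiv (Fin.consEquiv fun _ => X) _ _
    fun p => by simp [Fin.consEquiv, List.ofFn_succ]).symm

lemma sumLists_congr {n : ℕ} {F G : List X → ℝ} (h : ∀ l, l.length = n → F l = G l) :
    sumLists n F = sumLists n G :=
  Finset.sum_congr rfl fun _ _ => h _ (by simp)

lemma sumLists_sum_comm {ι : Type*} (s : Finset ι) (n : ℕ) (F : ι → List X → ℝ) :
    sumLists n (fun l => ∑ i ∈ s, F i l) = ∑ i ∈ s, sumLists n (F i) :=
  Finset.sum_comm

lemma mul_sumLists (c : ℝ) (n : ℕ) (F : List X → ℝ) :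
    c * sumLists n F = sumLists n fun l => c * F l :=
  Finset.mul_sum _ _ _

lemma sumLists_add (n : ℕ) (F G : List X → ℝ) :
    sumLists n (fun l => F l + G l) = sumLists n F + sumLists n G :=
  Finset.sum_add_distrib

lemma sumLists_nonneg {n : ℕ} {F : List X → ℝ} (h : ∀ l, 0 ≤ F l) : 0 ≤ sumLists n F :=
  Finset.sum_nonneg fun _ _ => h _

lemma le_sumLists {F : List X → ℝ} (h : ∀ l, 0 ≤ F l) (l : List X) :
    F l ≤ sumLists l.length F := by
  have := Finset.single_le_sum (f := fun v : Fin l.length → X => F (List.ofFn v))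
    (fun _ _ => h _) (Finset.mem_univ l.get)
  simpa [sumLists] using this

lemma sumLists_reverse (n : ℕ) (F : List X → ℝ) :
    sumLists n (fun l => F l.reverse) = sumLists n F := by
  have snoc : ∀ (n : ℕ) (F : List X → ℝ),
      sumLists (n + 1) F = ∑ x, sumLists n fun l => F (l ++ [x]) := by
    intro n
    induction n with
    | zero => intro F; rw [sumLists_succ]; rfl
    | succ n ih =>
      intro F
      rw [sumLists_succ]
      rw [Finset.sum_congr rfl fun x _ => ih _, Finset.sum_comm]
      exact Finset.sum_congr rfl fun y _ => (sumLists_succ n fun l => F (l ++ [y])).symm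
  induction n generalizing F with
  | zero => rfl
  | succ n ih =>
    rw [snoc n F, sumLists_succ]
    refine Finset.sum_congr rfl fun x _ => ?_
    simpa using ih fun l => F (l ++ [x])

end SumLists

namespace POMDP

section Forward

variable {Ω A S : Type*}

/-- The law of the next state after a reversed trajectory of `G₁`. -/
def nextLaw (M : POMDP Ω A S) : List (Ω × A) → Ω → ℝ
  | [] => M.p1
  | (ω, a) :: _ => M.P ω a

/-- The signals and actions along a list of states and actions. -/
def sig (M : POMDP Ω A S) (τ : List (Ω × A)) : List (S × A) :=
  τ.map fun p => (M.f p.1, p.2)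

/-- The (reversed) states and actions at the stages of a forward extended trajectory whose
coin is `true`, put on top of `acc`. -/
def active : List (Ω × A) → List (Ω × A × Bool) → List (Ω × A)
  | acc, [] => acc
  | acc, (ω, a, true) :: l => active ((ω, a) :: acc) l
  | acc, (_, _, false) :: l => active acc l

/-- The forward extended trajectory has exactly `k` coins equal to `true`, and its last coin
(if any) is one of them. -/
def EndsAt : ℕ → List (Ω × A × Bool) → Prop
  | k, [] => k = 0
  | 0, _ :: _ => False
  | k + 1, (_, _, true) :: l => EndsAt k l
  | k + 1, (_, _, false) :: l => EndsAt (k + 1) l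

lemma endsAt_append (k : ℕ) (l : List (Ω × A × Bool)) (p : Ω × A × Bool) :
    EndsAt k (l ++ [p]) ↔ p.2.2 = true ∧ (l ++ [p]).countP (fun q => q.2.2) = k := by
  induction l generalizing k with
  | nil =>
    obtain ⟨ω, a, x⟩ := p
    rcases k with _ | k <;> cases x <;> simp [EndsAt, eq_comm]
  | cons q l ih =>
    obtain ⟨ω, a, x⟩ := q
    rcases k with _ | k
    · simp only [List.cons_append, EndsAt, false_iff, not_and]
      intro hp hc
      have := List.countP_eq_zero.1 hc p (by simp)
      simp_all
    · cases x <;> simp [EndsAt, ih]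

lemma endsAt_ofFn (k : ℕ) {n : ℕ} (tr : Fin (n + 1) → Ω × A × Bool) :
    EndsAt k (List.ofFn tr) ↔ (tr (Fin.last n)).2.2 = true ∧
      (List.ofFn tr).countP (fun p => p.2.2) = k := by
  rw [List.ofFn_succ_last, endsAt_append]

lemma active_append (acc : List (Ω × A)) (l : List (Ω × A × Bool)) (ω : Ω) (a : A) :
    ∃ r, active acc (l ++ [(ω, a, true)]) = (ω, a) :: r := by
  induction l generalizing acc with
  | nil => exact ⟨acc, rfl⟩
  | cons q l ih =>
    obtain ⟨ω, a, x⟩ := q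
    cases x <;> simp only [List.cons_append, active] <;> exact ih _

variable [DecidableEq Ω]

/-- The law of the next state after a stage with state `ω`, action `a`, coin `x`. -/
def coinLaw (M : POMDP Ω A S) (ω : Ω) (a : A) (x : Bool) (ω' : Ω) : ℝ :=
  if x then M.P ω a ω' else if ω' = ω then 1 else 0

/-- The law of the next state after a reversed extended trajectory. -/
def nextLawE (M : POMDP Ω A S) : List (Ω × A × Bool) → Ω → ℝ
  | [] => M.p1
  | (ω, a, x) :: _ => M.coinLaw ω a x

/-- Probability of a forward extended trajectory continuing an observed reversed past `u`,
when the next state has law `d`. -/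
def fwdE (M : POMDP Ω A S) (h : ℝ) (σ : Strategy S A) :
    List (S × A) → (Ω → ℝ) → List (Ω × A × Bool) → ℝ
  | _, _, [] => 1
  | u, d, (ω, a, x) :: l =>
      d ω * σ (u, M.f ω) a * (if x then h else 1 - h) *
        fwdE M h σ ((M.f ω, a) :: u) (M.coinLaw ω a x) l

lemma etrajP_cons (M : POMDP Ω A S) (h : ℝ) (σ : Strategy S A) (ω : Ω) (a : A) (x : Bool)
    (R : List (Ω × A × Bool)) :
    M.etrajP h σ ((ω, a, x) :: R) =
      M.nextLawE R ω * σ (M.obsE R ω) a * (if x then h else 1 - h) * M.etrajP h σ R := by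
  rcases R with _ | ⟨⟨ω', a', x'⟩, R⟩ <;> rfl

lemma etrajP_reverse_append (M : POMDP Ω A S) (h : ℝ) (σ : Strategy S A)
    (l R : List (Ω × A × Bool)) :
    M.etrajP h σ (l.reverse ++ R) =
      M.fwdE h σ (R.map fun p => (M.f p.1, p.2.1)) (M.nextLawE R) l * M.etrajP h σ R := by
  induction l generalizing R with
  | nil => simp [fwdE]
  | cons p l ih =>
    obtain ⟨ω, a, x⟩ := p
    have := ih ((ω, a, x) :: R)
    simp only [List.reverse_cons, List.append_assoc, List.singleton_append, this, etrajP_cons,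
      fwdE, List.map_cons, nextLawE, obsE]
    ring

lemma eP_eq_fwdE (M : POMDP Ω A S) (h : ℝ) (σ : Strategy S A) {n : ℕ}
    (tr : Fin n → Ω × A × Bool) : M.eP h σ tr = M.fwdE h σ [] M.p1 (List.ofFn tr) := by
  simpa [eP, etrajP, nextLawE] using M.etrajP_reverse_append h σ (List.ofFn tr) []

lemma filAux_eq_obs (M : POMDP Ω A S) (h : ℝ) (σ : Strategy S A) (l : List (Ω × A × Bool))
    (k : ℕ) (ω : Ω) (a : A) (x : Bool) (acc r : List (Ω × A)) (ω' : Ω) (a' : A)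
    (u : List (S × A)) (d : Ω → ℝ) (hk : EndsAt k ((ω, a, x) :: l))
    (hw : M.fwdE h σ u d ((ω, a, x) :: l) ≠ 0)
    (hr : active acc ((ω, a, x) :: l) = (ω', a') :: r) :
    filAux M.f (M.sig acc) (M.f ω) ((ω, a, x) :: l) = M.obs r ω' := by
  induction l generalizing k ω a x acc u d with
  | nil =>
    rcases k with _ | k
    · exact hk.elim
    cases x
    · simp [EndsAt] at hk
    · simp only [active, List.cons.injEq, Prod.mk.injEq] at hr
      obtain ⟨⟨rfl, rfl⟩, rfl⟩ := hr
      rfl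
  | cons q l ih =>
    obtain ⟨ω₁, a₁, x₁⟩ := q
    rcases k with _ | k
    · exact hk.elim
    have hw' := right_ne_zero_of_mul hw
    cases x
    · have h1 : ω₁ = ω := by
        by_contra hne
        simp [fwdE, coinLaw, hne] at hw'
      subst h1
      simpa [filAux] using ih (k + 1) ω₁ a₁ x₁ acc _ _ hk hw' hr
    · simpa [filAux, sig] using ih k ω₁ a₁ x₁ ((ω, a) :: acc) _ _ hk hw' hr

lemma exists_active_ofFn (M : POMDP Ω A S) (h : ℝ) (σ : Strategy S A) {k n : ℕ}
    {tr : Fin (n + 1) → Ω × A × Bool} (htr : EndsAt k (List.ofFn tr)) :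
    ∃ r, active [] (List.ofFn tr) = ((tr (Fin.last n)).1, (tr (Fin.last n)).2.1) :: r ∧
      (M.fwdE h σ [] M.p1 (List.ofFn tr) ≠ 0 → M.filHist tr = M.obs r (tr (Fin.last n)).1) := by
  have hlast : tr (Fin.last n) = ((tr (Fin.last n)).1, (tr (Fin.last n)).2.1, true) := by
    rw [← ((endsAt_ofFn k tr).1 htr).1]
  obtain ⟨r, hr⟩ := active_append [] (List.ofFn fun i => tr (Fin.castSucc i))
    (tr (Fin.last n)).1 (tr (Fin.last n)).2.1
  rw [← hlast, ← List.ofFn_succ_last] at hr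
  refine ⟨r, hr, fun hw => ?_⟩
  rw [filHist]
  rw [List.ofFn_succ] at htr hw hr ⊢
  exact filAux_eq_obs M h σ _ k _ _ _ [] r _ _ _ _ htr hw hr

end Forward

section BlockWeight

variable {A S : Type*} [Fintype A]

/-- Given that the signals and actions at the active stages are those listed in the second
argument, the weight of the actions and coins for which the last active stage is the `n`-th
one, continuing an observed reversed past. -/
def blockW (h : ℝ) (σ : Strategy S A) : ℕ → List (S × A) → List (S × A) → ℝ
  | 0, _, [] => 1
  | 0, _, _ :: _ => 0
  | _ + 1, _, [] => 0
  | n + 1, u, (s, a) :: θ =>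
      h * σ (u, s) a * blockW h σ n ((s, a) :: u) θ +
        (1 - h) * ∑ b, σ (u, s) b * blockW h σ n ((s, b) :: u) ((s, a) :: θ)

variable {h : ℝ} {σ : Strategy S A}

lemma blockW_nonneg (hh : h ∈ Set.Ioo (0 : ℝ) 1) (hσ : IsStrategy σ) (n : ℕ)
    (u θ : List (S × A)) : 0 ≤ blockW h σ n u θ := by
  have h0 := hh.1
  have h1 : 0 < 1 - h := sub_pos.2 hh.2
  induction n generalizing u θ with
  | zero => cases θ <;> simp [blockW]
  | succ n ih =>
    rcases θ with _ | ⟨⟨s, a⟩, θ⟩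
    · simp [blockW]
    · exact add_nonneg (mul_nonneg (mul_nonneg h0.le (hσ.1 _ _)) (ih _ _))
        (mul_nonneg h1.le (Finset.sum_nonneg fun b _ => mul_nonneg (hσ.1 _ _) (ih _ _)))

lemma sum_blockW_zero (u θ : List (S × A)) (s : S) :
    ∑ a, blockW h σ 0 u (θ ++ [(s, a)]) = 0 := by
  cases θ <;> simp [blockW]

lemma sum_blockW_singleton (hσ : IsStrategy σ) (n : ℕ) (u : List (S × A)) (s : S) :
    ∑ a, blockW h σ (n + 1) u [(s, a)] = h * (1 - h) ^ n := by
  induction n generalizing u with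
  | zero => simp [blockW, ← Finset.mul_sum, hσ.2]
  | succ n ih =>
    have : ∑ a, ∑ b, σ (u, s) b * blockW h σ (n + 1) ((s, b) :: u) [(s, a)] =
        h * (1 - h) ^ n := by
      rw [Finset.sum_comm]
      simp_rw [← Finset.mul_sum, ih, ← Finset.sum_mul, hσ.2, one_mul]
    rw [Finset.sum_congr rfl fun _ _ => blockW.eq_4 .., Finset.sum_add_distrib,
      ← Finset.mul_sum, this]
    simp only [blockW, mul_zero, Finset.sum_const_zero]
    ring

lemma sum_blockW_succ_nil (hσ : IsStrategy σ) (n : ℕ) (u : List (S × A)) (s : S) :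
    ∑ a, blockW h σ (n + 1) u ([] ++ [(s, a)]) =
      h * blockW h σ n u [] + (1 - h) * ∑ a, blockW h σ n u ([] ++ [(s, a)]) := by
  simp only [List.nil_append, sum_blockW_singleton hσ]
  rcases n with _ | n
  · simp [blockW]
  · rw [sum_blockW_singleton hσ, blockW.eq_3]
    ring

lemma sum_blockW_succ (hσ : IsStrategy σ) (n : ℕ) (u θ : List (S × A)) (s : S) :
    ∑ a, blockW h σ (n + 1) u (θ ++ [(s, a)]) =
      h * blockW h σ n u θ + (1 - h) * ∑ a, blockW h σ n u (θ ++ [(s, a)]) := by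
  have unfold_cons : ∀ (n : ℕ) (u θ : List (S × A)) (s₀ : S) (a₀ : A),
      ∑ a, blockW h σ (n + 1) u ((s₀, a₀) :: θ ++ [(s, a)]) =
        h * σ (u, s₀) a₀ * ∑ a, blockW h σ n ((s₀, a₀) :: u) (θ ++ [(s, a)]) +
          (1 - h) * ∑ b, σ (u, s₀) b *
            ∑ a, blockW h σ n ((s₀, b) :: u) ((s₀, a₀) :: θ ++ [(s, a)]) := by
    intro n u θ s₀ a₀
    simp only [List.cons_append, blockW, Finset.sum_add_distrib, Finset.mul_sum]
    rw [Finset.sum_comm (γ := A)]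
  rcases θ with _ | ⟨⟨s₀, a₀⟩, θ⟩
  · exact sum_blockW_succ_nil hσ ..
  induction n generalizing u s₀ a₀ θ with
  | zero =>
    rw [unfold_cons]
    simp only [sum_blockW_zero, blockW]
    simp
  | succ n ih =>
    rw [unfold_cons (n + 1)]
    have tail : ∑ a, blockW h σ (n + 1) ((s₀, a₀) :: u) (θ ++ [(s, a)]) =
        h * blockW h σ n ((s₀, a₀) :: u) θ +
          (1 - h) * ∑ a, blockW h σ n ((s₀, a₀) :: u) (θ ++ [(s, a)]) := by
      rcases θ with _ | ⟨⟨s₁, a₁⟩, θ⟩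
      · exact sum_blockW_succ_nil hσ ..
      · exact ih ..
    have frozen : ∑ b, σ (u, s₀) b *
          ∑ a, blockW h σ (n + 1) ((s₀, b) :: u) ((s₀, a₀) :: θ ++ [(s, a)]) =
        h * ∑ b, σ (u, s₀) b * blockW h σ n ((s₀, b) :: u) ((s₀, a₀) :: θ) +
          (1 - h) * ∑ b, σ (u, s₀) b *
            ∑ a, blockW h σ n ((s₀, b) :: u) ((s₀, a₀) :: θ ++ [(s, a)]) := by
      rw [Finset.mul_sum, Finset.mul_sum, ← Finset.sum_add_distrib]
      refine Finset.sum_congr rfl fun b _ => ?_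
      rw [ih]
      ring
    rw [tail, frozen, unfold_cons n, blockW.eq_4]
    ring

lemma hasSum_blockW_append (hh : h ∈ Set.Ioo (0 : ℝ) 1) (hσ : IsStrategy σ)
    (u θ : List (S × A)) (s : S) {c : ℝ} (hc : HasSum (fun n => blockW h σ n u θ) c) :
    HasSum (fun n => ∑ a, blockW h σ n u (θ ++ [(s, a)])) c := by
  set E : ℕ → ℝ := fun n => ∑ a, blockW h σ n u (θ ++ [(s, a)])
  have hE0 : ∀ n, 0 ≤ E n := fun n => Finset.sum_nonneg fun a _ => blockW_nonneg hh hσ _ _ _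
  have hrec : ∀ N, ∑ n ∈ Finset.range (N + 1), E n =
      h * ∑ n ∈ Finset.range N, blockW h σ n u θ + (1 - h) * ∑ n ∈ Finset.range N, E n := by
    intro N
    rw [Finset.sum_range_succ']
    simp only [E, sum_blockW_zero, sum_blockW_succ hσ, Finset.sum_add_distrib, ← Finset.mul_sum,
      add_zero]
  have hbound : ∀ N, ∑ n ∈ Finset.range N, E n ≤ c := by
    intro N
    induction N with
    | zero => simpa using hc.nonneg fun n => blockW_nonneg hh hσ n u θ
    | succ N ih =>
      rw [hrec]
      have := sum_le_hasSum (Finset.range N) (fun n _ => blockW_nonneg hh hσ n u θ) hc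
      nlinarith [hh.1, hh.2]
  have hsum : Summable E := summable_of_sum_range_le hE0 hbound
  have hlim := hsum.hasSum.tendsto_sum_nat
  have heq := tendsto_nhds_unique ((tendsto_add_atTop_iff_nat 1).2 hlim)
    (((hc.tendsto_sum_nat.const_mul h).add (hlim.const_mul (1 - h))).congr fun N => (hrec N).symm)
  have : ∑' n, E n = c := mul_left_cancel₀ hh.1.ne' (by linarith)
  exact this ▸ hsum.hasSum

lemma summable_blockW (hh : h ∈ Set.Ioo (0 : ℝ) 1) (hσ : IsStrategy σ) (u θ : List (S × A)) :
    Summable fun n => blockW h σ n u θ := by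
  induction θ using List.reverseRecOn with
  | nil =>
    refine summable_of_ne_finset_zero (s := {0}) fun n hn => ?_
    rcases n with _ | n
    · simp at hn
    · rfl
  | append_singleton θ p ih =>
    obtain ⟨s, a⟩ := p
    refine (hasSum_blockW_append hh hσ u θ s ih.hasSum).summable.of_nonneg_of_le
      (fun n => blockW_nonneg hh hσ _ _ _) fun n => ?_
    exact Finset.single_le_sum (f := fun a => blockW h σ n u (θ ++ [(s, a)]))
      (fun _ _ => blockW_nonneg hh hσ _ _ _) (Finset.mem_univ a)

/-- The total weight of the actions and coins compatible with the reversed list `θ` of signals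
and actions at the active stages. -/
noncomputable def actW (h : ℝ) (σ : Strategy S A) (θ : List (S × A)) : ℝ :=
  ∑' n, blockW h σ n [] θ.reverse

lemma actW_nil : actW h σ ([] : List (S × A)) = 1 := by
  rw [actW, tsum_eq_single 0]
  · rfl
  · rintro (_ | n) hn
    · exact (hn rfl).elim
    · rfl

lemma actW_nonneg (hh : h ∈ Set.Ioo (0 : ℝ) 1) (hσ : IsStrategy σ) (θ : List (S × A)) :
    0 ≤ actW h σ θ :=
  tsum_nonneg fun _ => blockW_nonneg hh hσ _ _ _

lemma sum_actW (hh : h ∈ Set.Ioo (0 : ℝ) 1) (hσ : IsStrategy σ) (θ : List (S × A)) (s : S) :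
    ∑ a, actW h σ ((s, a) :: θ) = actW h σ θ := by
  simp only [actW, List.reverse_cons]
  rw [← Summable.tsum_finsetSum fun a _ => summable_blockW hh hσ _ _]
  exact (hasSum_blockW_append hh hσ _ _ s (summable_blockW hh hσ _ _).hasSum).tsum_eq

end BlockWeight

section Mimic

variable {Ω A S : Type*}

/-- Probability that states and actions follow `τ` (forward, the first state having law `d`),
given that the actions of `τ` are played. -/
def pathW (M : POMDP Ω A S) : (Ω → ℝ) → List (Ω × A) → ℝ
  | _, [] => 1
  | d, (ω, a) :: τ => d ω * pathW M (M.P ω a) τ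

/-- The same probability for a reversed list of states and actions. -/
def revPathW (M : POMDP Ω A S) : List (Ω × A) → ℝ
  | [] => 1
  | (ω, _) :: τ => M.nextLaw τ ω * revPathW M τ

lemma revPathW_reverse_append (M : POMDP Ω A S) (τ R : List (Ω × A)) :
    M.revPathW (τ.reverse ++ R) = M.pathW (M.nextLaw R) τ * M.revPathW R := by
  induction τ generalizing R with
  | nil => simp [pathW]
  | cons p τ ih =>
    have := ih (p :: R)
    simp only [List.reverse_cons, List.append_assoc, List.singleton_append, this, pathW,
      revPathW, nextLaw]
    ring

variable [Fintype Ω]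

lemma nextLaw_nonneg {M : POMDP Ω A S} (hM : M.IsValid) (τ : List (Ω × A)) (ω : Ω) :
    0 ≤ M.nextLaw τ ω := by
  rcases τ with _ | ⟨⟨ω', a'⟩, τ⟩
  · exact hM.2.2.1 ω
  · exact hM.1 ω' a' ω

lemma revPathW_nonneg {M : POMDP Ω A S} (hM : M.IsValid) (τ : List (Ω × A)) :
    0 ≤ M.revPathW τ := by
  induction τ with
  | nil => exact zero_le_one
  | cons p τ ih => exact mul_nonneg (nextLaw_nonneg hM _ _) ih

variable [Fintype A]

/-- The total probability of reaching the reversed trajectories with observation `η`. -/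
def obsW [DecidableEq A] [DecidableEq S] (M : POMDP Ω A S) (η : Hist S A) : ℝ :=
  ∑ ω, sumLists η.1.length fun τ => if M.obs τ ω = η then M.nextLaw τ ω * M.revPathW τ else 0

lemma le_obsW [DecidableEq A] [DecidableEq S] {M : POMDP Ω A S} (hM : M.IsValid)
    (τ : List (Ω × A)) (ω : Ω) :
    M.nextLaw τ ω * M.revPathW τ ≤ M.obsW (M.obs τ ω) := by
  have hterm : ∀ (ω' : Ω) (τ' : List (Ω × A)), 0 ≤ if M.obs τ' ω' = M.obs τ ω then
      M.nextLaw τ' ω' * M.revPathW τ' else 0 := by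
    intro ω' τ'
    split_ifs
    exacts [mul_nonneg (nextLaw_nonneg hM _ _) (revPathW_nonneg hM _), le_rfl]
  have h1 := le_sumLists (hterm ω) τ
  have h2 := Finset.single_le_sum (fun ω' _ => sumLists_nonneg (n := τ.length) (hterm ω'))
    (Finset.mem_univ ω)
  have hlen : (M.obs τ ω).1.length = τ.length := by simp [obs]
  rw [obsW, hlen]
  simpa using h1.trans h2

variable [DecidableEq Ω]

open Classical in
/-- Summing over the extended trajectories of length `n` with last active stage `n`. -/
lemma sumLists_fwdE (M : POMDP Ω A S) (h : ℝ) (σ : Strategy S A) (G : List (Ω × A) → ℝ)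
    (n k : ℕ) (u : List (S × A)) (d : Ω → ℝ) (acc : List (Ω × A)) :
    sumLists n (fun l => if EndsAt k l then M.fwdE h σ u d l * G (active acc l) else 0) =
      sumLists k fun τ => M.pathW d τ * blockW h σ n u (M.sig τ) * G (τ.reverse ++ acc) := by
  induction n generalizing k u d acc with
  | zero =>
    rw [sumLists_zero]
    rcases k with _ | k
    · simp [sumLists_zero, EndsAt, fwdE, active, pathW, sig, blockW]
    · simp [EndsAt, sig, blockW, sumLists]
  | succ n ih =>
    rcases k with _ | k
    · simp [EndsAt, sig, blockW, sumLists]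
    have active_stage : ∀ ω a, sumLists n (fun l => if EndsAt (k + 1) ((ω, a, true) :: l) then
          M.fwdE h σ u d ((ω, a, true) :: l) * G (active acc ((ω, a, true) :: l)) else 0) =
        d ω * σ (u, M.f ω) a * h * sumLists k fun τ => M.pathW (M.P ω a) τ *
          blockW h σ n ((M.f ω, a) :: u) (M.sig τ) * G (τ.reverse ++ (ω, a) :: acc) := by
      intro ω a
      rw [← ih k _ _ ((ω, a) :: acc), mul_sumLists]
      refine sumLists_congr fun l _ => ?_
      have : M.coinLaw ω a true = M.P ω a := by ext; simp [coinLaw]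
      simp [EndsAt, fwdE, active, this, mul_assoc]
    have frozen_stage : ∀ ω b, sumLists n (fun l => if EndsAt (k + 1) ((ω, b, false) :: l) then
          M.fwdE h σ u d ((ω, b, false) :: l) * G (active acc ((ω, b, false) :: l)) else 0) =
        d ω * σ (u, M.f ω) b * (1 - h) * ∑ a, sumLists k fun τ => M.pathW (M.P ω a) τ *
          blockW h σ n ((M.f ω, b) :: u) ((M.f ω, a) :: M.sig τ) *
            G (τ.reverse ++ (ω, a) :: acc) := by
      intro ω b
      have := ih (k + 1) ((M.f ω, b) :: u) (M.coinLaw ω b false) acc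
      rw [sumLists_succ k, Fintype.sum_prod_type, Finset.sum_eq_single ω] at this
      · simp only [coinLaw, pathW, sig, List.map_cons, List.reverse_cons, List.append_assoc,
          List.singleton_append, if_true, one_mul, Bool.false_eq_true, if_false] at this
        simp only [sig, ← this, mul_sumLists]
        refine sumLists_congr fun l _ => ?_
        have : M.coinLaw ω b false = fun ω' => if ω' = ω then 1 else 0 := by ext; simp [coinLaw]
        simp [EndsAt, fwdE, active, this, mul_assoc]
      · intro ω' _ hne
        simp [pathW, coinLaw, hne, sumLists]
      · simp
    rw [sumLists_succ, sumLists_succ, Fintype.sum_prod_type, Fintype.sum_prod_type]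
    refine Finset.sum_congr rfl fun ω _ => ?_
    simp_rw [Fintype.sum_prod_type, Fintype.sum_bool, active_stage, frozen_stage]
    have split_block : ∀ a, (sumLists k fun τ => M.pathW d ((ω, a) :: τ) *
          blockW h σ (n + 1) u (M.sig ((ω, a) :: τ)) * G (((ω, a) :: τ).reverse ++ acc)) =
        (d ω * σ (u, M.f ω) a * h * sumLists k fun τ => M.pathW (M.P ω a) τ *
          blockW h σ n ((M.f ω, a) :: u) (M.sig τ) * G (τ.reverse ++ (ω, a) :: acc)) +
        ∑ b, d ω * σ (u, M.f ω) b * (1 - h) * sumLists k fun τ => M.pathW (M.P ω a) τ *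
          blockW h σ n ((M.f ω, b) :: u) ((M.f ω, a) :: M.sig τ) *
            G (τ.reverse ++ (ω, a) :: acc) := by
      intro a
      simp_rw [mul_sumLists]
      rw [← sumLists_sum_comm, ← sumLists_add]
      refine sumLists_congr fun τ _ => ?_
      simp only [pathW, sig, List.map_cons, blockW, List.reverse_cons, List.append_assoc,
        List.singleton_append, mul_add, add_mul, Finset.mul_sum, Finset.sum_mul]
      refine congrArg₂ _ (by ring) (Finset.sum_congr rfl fun b _ => by ring)
    simp_rw [split_block, Finset.sum_add_distrib, Finset.mul_sum]
    rw [Finset.sum_comm (γ := A)]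

open Classical in
/-- The expectation of a function of the trajectory along the first `k` active stages. -/
lemma hasSum_active (M : POMDP Ω A S) {h : ℝ} (hh : h ∈ Set.Ioo (0 : ℝ) 1) {σ : Strategy S A}
    (hσ : IsStrategy σ) (G : List (Ω × A) → ℝ) {k : ℕ} (hk : 1 ≤ k) :
    HasSum (fun n => sumLists (n + 1) fun l =>
        if EndsAt k l then M.fwdE h σ [] M.p1 l * G (active [] l) else 0)
      (sumLists k fun τ => M.revPathW τ * actW h σ (M.sig τ) * G τ) := by
  have hterm : ∀ n, (sumLists (n + 1) fun l =>
      if EndsAt k l then M.fwdE h σ [] M.p1 l * G (active [] l) else 0) =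
      sumLists k fun τ => M.revPathW τ * blockW h σ (n + 1) [] (M.sig τ).reverse * G τ := by
    intro n
    rw [sumLists_fwdE, ← sumLists_reverse k fun τ =>
      M.revPathW τ * blockW h σ (n + 1) [] (M.sig τ).reverse * G τ]
    refine sumLists_congr fun τ _ => ?_
    have := M.revPathW_reverse_append τ []
    simp only [List.append_nil, nextLaw, revPathW, mul_one] at this
    simp [this, sig]
  simp_rw [hterm]
  refine hasSum_sum fun v _ => ?_
  refine ((HasSum.mul_left _ ?_).mul_right _)
  have hsum := (summable_blockW hh hσ [] (M.sig (List.ofFn v)).reverse).hasSum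
  have hzero : blockW h σ 0 [] (M.sig (List.ofFn v)).reverse = 0 := by
    rcases hθ : (M.sig (List.ofFn v)).reverse with _ | ⟨p, θ⟩
    · have := congrArg List.length hθ
      simp [sig] at this
      lia
    · rfl
  simpa [hzero, actW] using (hasSum_nat_add_iff' 1).2 hsum

variable [DecidableEq A] [DecidableEq S]

lemma jointFil_eq (M : POMDP Ω A S) {h : ℝ} (hh : h ∈ Set.Ioo (0 : ℝ) 1) {σ : Strategy S A}
    (hσ : IsStrategy σ) (k : ℕ) (η : Hist S A) (ω : Ω) (a : A) :
    M.jointFil h σ (k + 1) η ω a = actW h σ ((η.2, a) :: η.1) *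
      sumLists k fun τ => if M.obs τ ω = η then M.nextLaw τ ω * M.revPathW τ else 0 := by
  classical
  let G : List (Ω × A) → ℝ := fun τ =>
    match τ with
    | [] => 0
    | (ω', a') :: r => if M.obs r ω' = η ∧ ω' = ω ∧ a' = a then 1 else 0
  have hG : M.jointFil h σ (k + 1) η ω a =
      sumLists (k + 1) fun τ => M.revPathW τ * actW h σ (M.sig τ) * G τ := by
    rw [← (M.hasSum_active hh hσ G (Nat.le_add_left 1 k)).tsum_eq]
    refine tsum_congr fun n => Finset.sum_congr rfl fun tr _ => ?_
    simp_rw [← and_assoc, ← endsAt_ofFn, eP_eq_fwdE]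
    by_cases htr : EndsAt (k + 1) (List.ofFn tr)
    · obtain ⟨r, hr, hfil⟩ := M.exists_active_ofFn h σ htr
      by_cases hw : M.fwdE h σ [] M.p1 (List.ofFn tr) = 0
      · simp [hw, -List.ofFn_succ]
      · simp [htr, hr, hfil hw, G, and_assoc, -List.ofFn_succ]
    · simp [htr, -List.ofFn_succ]
  rw [hG, sumLists_succ, Finset.sum_eq_single (ω, a), mul_sumLists]
  · refine sumLists_congr fun τ _ => ?_
    by_cases hτ : M.obs τ ω = η
    · subst hτ
      simp [G, revPathW, obs, sig]
      ring
    · simp [G, hτ]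
  · rintro ⟨ω', a'⟩ _ hne
    have : ¬ (ω' = ω ∧ a' = a) := by simpa using hne
    simp [G, this, sumLists]
  · simp

lemma jointFilA_eq (M : POMDP Ω A S) {h : ℝ} (hh : h ∈ Set.Ioo (0 : ℝ) 1) {σ : Strategy S A}
    (hσ : IsStrategy σ) (η : Hist S A) (a : A) :
    M.jointFilA h σ (η.1.length + 1) η a = actW h σ ((η.2, a) :: η.1) * M.obsW η := by
  simp_rw [jointFilA, M.jointFil_eq hh hσ, ← Finset.mul_sum, obsW]

lemma probFil_eq (M : POMDP Ω A S) {h : ℝ} (hh : h ∈ Set.Ioo (0 : ℝ) 1) {σ : Strategy S A}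
    (hσ : IsStrategy σ) (η : Hist S A) :
    M.probFil h σ (η.1.length + 1) η = actW h σ η.1 * M.obsW η := by
  simp_rw [probFil, M.jointFilA_eq hh hσ, ← Finset.sum_mul, sum_actW hh hσ]

/-- The trajectory in `G₁` under the mimicking strategy has the law of the trajectory along
the active stages in `G_h`. -/
lemma trajP_mimic {M : POMDP Ω A S} (hM : M.IsValid) {h : ℝ} (hh : h ∈ Set.Ioo (0 : ℝ) 1)
    {σ : Strategy S A} (hσ : IsStrategy σ) (ρ : A → ℝ) (τ : List (Ω × A)) :
    M.trajP (mimic M h σ ρ) τ = M.revPathW τ * actW h σ (M.sig τ) := by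
  induction τ with
  | nil => simp [trajP, revPathW, sig, actW_nil]
  | cons p τ ih =>
    obtain ⟨ω, a⟩ := p
    have hcons : M.trajP (mimic M h σ ρ) ((ω, a) :: τ) =
        M.nextLaw τ ω * mimic M h σ ρ (M.obs τ ω) a * M.trajP (mimic M h σ ρ) τ := by
      rcases τ with _ | ⟨⟨ω', a'⟩, τ⟩ <;> rfl
    have hpath := mul_nonneg (nextLaw_nonneg hM τ ω) (revPathW_nonneg hM τ)
    have hle := le_obsW hM τ ω
    have hact := Finset.single_le_sum (f := fun a => actW h σ ((M.f ω, a) :: M.sig τ))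
      (fun a _ => actW_nonneg hh hσ _) (Finset.mem_univ a)
    rw [sum_actW hh hσ] at hact
    have hact0 := actW_nonneg hh hσ ((M.f ω, a) :: M.sig τ)
    change M.trajP _ _ = M.nextLaw τ ω * M.revPathW τ * actW h σ ((M.f ω, a) :: M.sig τ)
    rw [hcons, ih, mimic, probFil_eq M hh hσ, jointFilA_eq M hh hσ]
    change M.nextLaw τ ω * (if actW h σ (M.sig τ) * M.obsW (M.obs τ ω) = 0 then ρ a else
      actW h σ ((M.f ω, a) :: M.sig τ) * M.obsW (M.obs τ ω) /
        (actW h σ (M.sig τ) * M.obsW (M.obs τ ω))) * (M.revPathW τ * actW h σ (M.sig τ)) = _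
    split_ifs with h0
    · rcases mul_eq_zero.1 h0 with h1 | h1
      · rw [h1] at hact ⊢
        rw [le_antisymm hact hact0]
        ring
      · rw [h1] at hle
        have := le_antisymm hle hpath
        rw [this, zero_mul]
        linear_combination ρ a * actW h σ (M.sig τ) * this
    · have h1 := left_ne_zero_of_mul h0
      have h2 := right_ne_zero_of_mul h0
      field_simp

end Mimic

end POMDP

open POMDP in
/-- For the mimicking strategy `σ̂` of `σ` and every `k ≥ 1`,
`E^1_{σ̂}[g(ω_k, a_k)] = E^h_σ[g(ω'_{T_k}, a'_{T_k})]`. -/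
theorem mimic_stage_payoff {Ω A S : Type*} [Fintype Ω] [Fintype A]
    [DecidableEq Ω] [DecidableEq A] [DecidableEq S]
    (M : POMDP Ω A S) (hM : M.IsValid) (h : ℝ) (hh : h ∈ Set.Ioo (0 : ℝ) 1)
    (σ : Strategy S A) (hσ : IsStrategy σ)
    (ρ : A → ℝ) (hρ : (∀ a, 0 ≤ ρ a) ∧ ∑ a, ρ a = 1)
    (k : ℕ) (hk : 1 ≤ k) :
    stageE M (mimic M h σ ρ) (k - 1) = ETk M h σ k := by
  obtain ⟨m, rfl⟩ := Nat.exists_eq_add_of_le' hk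
  let G : List (Ω × A) → ℝ := fun τ =>
    match τ with
    | [] => 0
    | (ω, a) :: _ => M.g ω a
  calc stageE M (mimic M h σ ρ) (m + 1 - 1)
      = sumLists (m + 1) fun τ => M.revPathW τ * actW h σ (M.sig τ) * G τ := by
        refine Finset.sum_congr rfl fun tr _ => ?_
        simp only [trajP_mimic hM hh hσ]
        congr 1
        simp [G, List.ofFn_succ]
    _ = ETk M h σ (m + 1) := by
        classical
        rw [← (M.hasSum_active hh hσ G hk).tsum_eq]
        refine tsum_congr fun n => Finset.sum_congr rfl fun tr _ => ?_
        simp_rw [← endsAt_ofFn, eP_eq_fwdE]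
        by_cases htr : EndsAt (m + 1) (List.ofFn tr)
        · obtain ⟨r, hr, -⟩ := M.exists_active_ofFn h σ htr
          simp [htr, hr, G, -List.ofFn_succ]
        · simp [htr, -List.ofFn_succ]
end

section
/- Let h ∈ (0,1) and let σ be a behavior strategy in G_h. Then for every k ≥ 1, E^h_σ[Σ_{j=T_{k−1}+1}^{T_k} g(ω'_j, a'_j)] = (1/h) · E^h_σ[g(ω'_{T_k}, a'_{T_k})]. -/
open Filter

namespace POMDP

variable {Ω A S : Type*} [Fintype Ω] [Fintype A] [DecidableEq Ω]

/-- `E^h_σ[∑_{j=T_{k-1}+1}^{T_k} g(ω'_j, a'_j)]`, decomposed over stages `j = n+1`: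
stage `j` belongs to the `k`-th epoch, i.e. `T_{k-1} < j ≤ T_k`, iff there are
exactly `k - 1` `true` coins among the first `j - 1` stages. -/
noncomputable def Eepoch (M : POMDP Ω A S) (h : ℝ) (σ : Strategy S A) (k : ℕ) : ℝ :=
  ∑' n : ℕ, ∑ tr : Fin (n + 1) → Ω × A × Bool,
    if (List.ofFn tr).dropLast.countP (fun p => p.2.2) = k - 1 then
      eP M h σ tr * M.g (tr (Fin.last n)).1 (tr (Fin.last n)).2.1
    else 0

end POMDP

namespace POMDP

variable {Ω A S : Type*} [DecidableEq Ω]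

/-- The coin flipped at the last stage is independent of everything observed up to that stage. -/
theorem etrajP_cons_coin (M : POMDP Ω A S) (h : ℝ) (σ : Strategy S A)
    (l : List (Ω × A × Bool)) (ω : Ω) (a : A) :
    etrajP M h σ ((ω, a, true) :: l) =
      h * (etrajP M h σ ((ω, a, true) :: l) + etrajP M h σ ((ω, a, false) :: l)) := by
  simp only [etrajP, if_true, Bool.false_eq_true, if_false]
  ring

/-- Stage by stage, the payoff collected at the end of epoch `k + 1` is `h` times the payoff
collected during that epoch. -/
theorem sum_end_of_epoch_eq [Fintype Ω] [Fintype A] (M : POMDP Ω A S) (h : ℝ) (σ : Strategy S A)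
    (k n : ℕ) :
    (∑ tr : Fin (n + 1) → Ω × A × Bool,
      if (tr (Fin.last n)).2.2 = true ∧
          (List.ofFn tr).countP (fun p => p.2.2) = k + 1 then
        eP M h σ tr * M.g (tr (Fin.last n)).1 (tr (Fin.last n)).2.1
      else 0) =
    h * ∑ tr : Fin (n + 1) → Ω × A × Bool,
      if (List.ofFn tr).dropLast.countP (fun p => p.2.2) = k then
        eP M h σ tr * M.g (tr (Fin.last n)).1 (tr (Fin.last n)).2.1
      else 0 := by
  rw [← (Fin.snocEquiv fun _ => Ω × A × Bool).sum_comp,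
    ← (Fin.snocEquiv fun _ => Ω × A × Bool).sum_comp, Fintype.sum_prod_type_right,
    Fintype.sum_prod_type_right]
  simp only [Fintype.sum_prod_type, Fintype.sum_bool, Finset.mul_sum]
  refine Finset.sum_congr rfl fun init _ => Finset.sum_congr rfl fun ω _ =>
    Finset.sum_congr rfl fun a _ => ?_
  have hcoin := etrajP_cons_coin M h σ (List.ofFn init).reverse ω a
  by_cases hk : (List.ofFn init).countP (fun p => p.2.2) = k
  · simp [Fin.snocEquiv, eP, List.ofFn_succ', hk, -List.ofFn_succ]
    linear_combination M.g ω a * hcoin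
  · simp [Fin.snocEquiv, List.ofFn_succ', hk, -List.ofFn_succ]

end POMDP

/-- For every `k ≥ 1`,
`E^h_σ[∑_{j=T_{k-1}+1}^{T_k} g(ω'_j, a'_j)] = (1/h) · E^h_σ[g(ω'_{T_k}, a'_{T_k})]`. -/
theorem epoch_payoff_eq {Ω A S : Type*} [Fintype Ω] [Fintype A] [DecidableEq Ω]
    (M : POMDP Ω A S) (hM : M.IsValid) (h : ℝ) (hh : h ∈ Set.Ioo (0 : ℝ) 1)
    (σ : Strategy S A) (hσ : IsStrategy σ) (k : ℕ) (hk : 1 ≤ k) :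
    POMDP.Eepoch M h σ k = (1 / h) * POMDP.ETk M h σ k := by
  obtain ⟨k, rfl⟩ := Nat.exists_eq_add_of_le' hk
  have hne : h ≠ 0 := hh.1.ne'
  simp only [POMDP.Eepoch, POMDP.ETk, POMDP.sum_end_of_epoch_eq, tsum_mul_left,
    Nat.add_sub_cancel]
  field_simp
end

section
/- Let h ∈ (0,1), let σ be a behavior strategy in G_h, and set t_k = ⌊k/h⌋. Then liminf_{k→∞} E^h_σ[(1/t_k) Σ_{j=1}^{t_k} g(ω'_j, a'_j)] = liminf_{k→∞} E^h_σ[(h/k) Σ_{j=1}^{T_k} g(ω'_j, a'_j)]. -/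
open Filter

namespace POMDP

variable {Ω A S : Type*} [Fintype Ω] [Fintype A] [DecidableEq Ω]

/-- `E^h_σ[∑_{j=1}^{T_k} g(ω'_j, a'_j)]`, decomposed over stages `j = n+1`:
stage `j` satisfies `j ≤ T_k` iff there are fewer than `k` `true` coins among
the first `j - 1` stages. -/
noncomputable def EuptoT (M : POMDP Ω A S) (h : ℝ) (σ : Strategy S A) (k : ℕ) : ℝ :=
  ∑' n : ℕ, ∑ tr : Fin (n + 1) → Ω × A × Bool,
    if (List.ofFn tr).dropLast.countP (fun p => p.2.2) < k then
      eP M h σ tr * M.g (tr (Fin.last n)).1 (tr (Fin.last n)).2.1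
    else 0

/-- `E^h_σ[g(ω'_{n+1}, a'_{n+1})]` on the extended space for `G_h`. -/
noncomputable def stageEext (M : POMDP Ω A S) (h : ℝ) (σ : Strategy S A) (n : ℕ) : ℝ :=
  ∑ tr : Fin (n + 1) → Ω × A × Bool,
    eP M h σ tr * M.g (tr (Fin.last n)).1 (tr (Fin.last n)).2.1

end POMDP

/-- A nonnegative sequence with `u (n+1) = r n + q * u n`, `q < 1` and `r` summable is summable. -/
lemma summable_of_affine_recurrence {u r : ℕ → ℝ} {q : ℝ} (hq : q < 1)
    (hu : ∀ n, 0 ≤ u n) (hr0 : ∀ n, 0 ≤ r n) (hr : Summable r)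
    (hrec : ∀ n, u (n + 1) = r n + q * u n) : Summable u := by
  refine summable_of_sum_range_le (c := (u 0 + ∑' n, r n) / (1 - q)) hu fun N => ?_
  have h1 : ∑ n ∈ Finset.range N, u n ≤ ∑ n ∈ Finset.range (N + 1), u n := by
    rw [Finset.sum_range_succ]
    linarith [hu N]
  rw [Finset.sum_range_succ'] at h1
  simp only [hrec, Finset.sum_add_distrib, ← Finset.mul_sum] at h1
  have h2 : ∑ n ∈ Finset.range N, r n ≤ ∑' n, r n := hr.sum_le_tsum _ fun n _ => hr0 n
  rw [le_div_iff₀ (by linarith)]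
  linarith

/-- `b n k` has the recursive structure of `ℙ(T_k > n)`, where `T_k` is the time of the
`k`-th success among independent Bernoulli(`h`) trials. -/
structure IsNegBinTail (h : ℝ) (b : ℕ → ℕ → ℝ) : Prop where
  nonneg : ∀ n k, 0 ≤ b n k
  le_one : ∀ n k, b n k ≤ 1
  zero_right : ∀ n, b n 0 = 0
  zero_left : ∀ k, b 0 (k + 1) = 1
  succ_succ : ∀ n k, b (n + 1) (k + 1) = h * b n k + (1 - h) * b n (k + 1)

namespace IsNegBinTail

variable {h : ℝ} {b : ℕ → ℕ → ℝ}

/-- `𝔼[T_k] = k / h`. -/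
lemma hasSum (hb : IsNegBinTail h b) (hh : h ∈ Set.Ioo (0 : ℝ) 1) (k : ℕ) :
    HasSum (fun n => b n k) (k / h) := by
  have hpos : h ≠ 0 := hh.1.ne'
  induction k with
  | zero => simp [hb.zero_right]
  | succ k ih =>
    have hs : Summable fun n => b n (k + 1) :=
      summable_of_affine_recurrence (r := fun n => h * b n k) (q := 1 - h) (by linarith [hh.1])
        (fun n => hb.nonneg n _) (fun n => mul_nonneg hh.1.le (hb.nonneg n k))
        (ih.summable.mul_left h) fun n => hb.succ_succ n k
    have h1 := (hasSum_nat_add_iff' 1).2 hs.hasSum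
    simp only [hb.succ_succ, Finset.sum_range_one, hb.zero_left] at h1
    have h2 := h1.unique ((ih.mul_left h).add (hs.hasSum.mul_left (1 - h)))
    convert hs.hasSum using 1
    push_cast
    field_simp at h2 ⊢
    linarith

/-- `𝔼[T_k (T_k - 1) / 2] = k (k + 1 - 2 h) / (2 h ^ 2)`. -/
lemma hasSum_nat_mul (hb : IsNegBinTail h b) (hh : h ∈ Set.Ioo (0 : ℝ) 1) (k : ℕ) :
    HasSum (fun n : ℕ => n * b n k) (k * (k + 1 - 2 * h) / (2 * h ^ 2)) := by
  have hpos : h ≠ 0 := hh.1.ne'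
  induction k with
  | zero => simp [hb.zero_right]
  | succ k ih =>
    have hr : HasSum (fun n : ℕ => h * (n * b n k + b n k) + (1 - h) * b n (k + 1)) _ :=
      ((ih.add (hb.hasSum hh k)).mul_left h).add ((hb.hasSum hh (k + 1)).mul_left (1 - h))
    have hrec : ∀ n : ℕ, ((n + 1 : ℕ) : ℝ) * b (n + 1) (k + 1)
        = (h * (n * b n k + b n k) + (1 - h) * b n (k + 1)) + (1 - h) * (n * b n (k + 1)) := by
      intro n
      rw [hb.succ_succ]
      push_cast
      ring
    have hs : Summable fun n : ℕ => n * b n (k + 1) := by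
      refine summable_of_affine_recurrence (by linarith [hh.1])
        (fun n => mul_nonneg n.cast_nonneg (hb.nonneg n _)) (fun n => ?_) hr.summable hrec
      have := hb.nonneg n k
      have := hb.nonneg n (k + 1)
      have := hh.1
      have : 0 < 1 - h := by linarith [hh.2]
      positivity
    have h1 := (hasSum_nat_add_iff' 1).2 hs.hasSum
    simp only [hrec, Finset.sum_range_one, Nat.cast_zero, zero_mul, sub_zero] at h1
    have h2 := h1.unique (hr.add (hs.hasSum.mul_left (1 - h)))
    convert hs.hasSum using 1
    push_cast at h2 ⊢
    field_simp at h2 ⊢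
    linarith

/-- `𝔼[(T_k - t)²] = k (1 - h) / h ^ 2 + (k / h - t) ^ 2`, as a tail sum. -/
lemma hasSum_sq_dev (hb : IsNegBinTail h b) (hh : h ∈ Set.Ioo (0 : ℝ) 1) (k t : ℕ) :
    HasSum (fun n : ℕ => (2 * ((n : ℝ) - t) + 1) * (b n k - if n < t then 1 else 0))
      (k * (1 - h) / h ^ 2 + (k / h - t) ^ 2) := by
  have hpos : h ≠ 0 := hh.1.ne'
  have hI : HasSum (fun n : ℕ => (2 * ((n : ℝ) - t) + 1) * if n < t then (1 : ℝ) else 0)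
      (-(t : ℝ) ^ 2) := by
    have h1 := hasSum_sum_of_ne_finset_zero (L := .unconditional ℕ) (s := Finset.range t)
      (f := fun n : ℕ => (2 * ((n : ℝ) - t) + 1) * if n < t then (1 : ℝ) else 0)
      (by intro n hn; simp at hn; simp [hn])
    convert h1 using 1
    have h2 : ∀ m : ℕ, ∑ n ∈ Finset.range m, (2 * ((n : ℝ) - t) + 1) = m ^ 2 - 2 * t * m := by
      intro m
      induction m with
      | zero => simp
      | succ m ih => rw [Finset.sum_range_succ, ih]; push_cast; ring
    rw [Finset.sum_congr rfl (g := fun n : ℕ => 2 * ((n : ℝ) - t) + 1), h2]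
    · ring
    · intro n hn
      simp [Finset.mem_range.1 hn]
  have h1 := (((hb.hasSum_nat_mul hh k).mul_left 2).add
    ((hb.hasSum hh k).mul_left (1 - 2 * (t : ℝ)))).sub hI
  have h2 : (k : ℝ) * (1 - h) / h ^ 2 + (k / h - t) ^ 2
      = 2 * (k * (k + 1 - 2 * h) / (2 * h ^ 2)) + (1 - 2 * (t : ℝ)) * (k / h) - -(t : ℝ) ^ 2 := by
    field_simp
    ring
  rw [h2]
  refine (congrArg (HasSum · _) (funext fun n => ?_)).mp h1
  ring

/-- `𝔼|T_k - t| ≤ 2 s + 𝔼[(T_k - t)²] / s`, with the expectations written as tail sums. -/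
lemma abs_dev_le (hb : IsNegBinTail h b) (hh : h ∈ Set.Ioo (0 : ℝ) 1) (k t s : ℕ) (hs : 0 < s) :
    Summable (fun n : ℕ => |b n k - if n < t then 1 else 0|) ∧
    ∑' n : ℕ, |b n k - if n < t then 1 else 0|
      ≤ 2 * s + (k * (1 - h) / h ^ 2 + (k / h - t) ^ 2) / s := by
  have hs' : (0 : ℝ) < s := by exact_mod_cast hs
  have hw : HasSum (fun n : ℕ => if n ∈ Finset.Ico (t - s) (t + s) then (1 : ℝ) else 0)
      ((Finset.Ico (t - s) (t + s)).card : ℝ) := by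
    have h1 := hasSum_sum_of_ne_finset_zero (L := .unconditional ℕ) (s := Finset.Ico (t - s) (t + s))
      (f := fun n : ℕ => if n ∈ Finset.Ico (t - s) (t + s) then (1 : ℝ) else 0)
      (by intro n hn; simp only [hn, if_false])
    rwa [Finset.sum_ite_mem, Finset.inter_self, Finset.sum_const, nsmul_one] at h1
  have hle : ∀ n : ℕ, |b n k - if n < t then 1 else 0| ≤
      (if n ∈ Finset.Ico (t - s) (t + s) then (1 : ℝ) else 0) +
        (2 * ((n : ℝ) - t) + 1) * (b n k - if n < t then 1 else 0) / s := by
    intro n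
    have h0 := hb.nonneg n k
    have h1 := hb.le_one n k
    rw [← sub_le_iff_le_add', le_div_iff₀ hs']
    by_cases hnt : n < t
    · have h2 : (n : ℝ) + 1 ≤ t := by exact_mod_cast hnt
      simp only [hnt, if_true]
      rw [abs_of_nonpos (by linarith)]
      split_ifs with hmem
      · nlinarith
      · have h3 : (n : ℝ) + s + 1 ≤ t := by
          have : n + s + 1 ≤ t := by simp at hmem; omega
          exact_mod_cast this
        nlinarith
    · have h2 : (t : ℝ) ≤ n := by exact_mod_cast not_lt.1 hnt
      simp only [hnt, if_false, sub_zero]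
      rw [abs_of_nonneg h0]
      split_ifs with hmem
      · nlinarith
      · have h3 : (t : ℝ) + s ≤ n := by
          have : t + s ≤ n := by simp at hmem; omega
          exact_mod_cast this
        nlinarith
  have hsum := hw.add ((hb.hasSum_sq_dev hh k t).div_const (s : ℝ))
  have hS : Summable (fun n : ℕ => |b n k - if n < t then 1 else 0|) :=
    Summable.of_nonneg_of_le (fun n => abs_nonneg _) hle hsum.summable
  refine ⟨hS, (hasSum_le hle hS.hasSum hsum).trans ?_⟩
  have : ((Finset.Ico (t - s) (t + s)).card : ℝ) ≤ 2 * s := by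
    rw [Nat.card_Ico]
    have : t + s - (t - s) ≤ 2 * s := by omega
    exact_mod_cast this
  linarith

end IsNegBinTail

/-- If `u - v` tends to `0` and `u` is bounded, then `liminf u ≤ liminf v`. -/
lemma liminf_le_liminf_of_tendsto_sub {u v : ℕ → ℝ} {C : ℝ} (hu : ∀ᶠ n in atTop, |u n| ≤ C)
    (hv : ∀ᶠ n in atTop, |v n| ≤ C) (huv : Tendsto (fun n => u n - v n) atTop (nhds 0)) :
    liminf u atTop ≤ liminf v atTop := by
  have bdd : ∀ {w : ℕ → ℝ}, (∀ᶠ n in atTop, |w n| ≤ C) →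
      IsBoundedUnder (· ≥ ·) atTop w ∧ IsCoboundedUnder (· ≥ ·) atTop w := fun hw =>
    ⟨isBoundedUnder_of_eventually_ge (a := -C) (hw.mono fun n hn => (abs_le.1 hn).1),
      (isBoundedUnder_of_eventually_le (a := C)
        (hw.mono fun n hn => (abs_le.1 hn).2)).isCoboundedUnder_ge⟩
  refine le_of_forall_pos_le_add fun ε hε => ?_
  have h1 : ∀ᶠ n in atTop, liminf u atTop - ε / 2 < u n :=
    eventually_lt_of_lt_liminf (by linarith) (bdd hu).1
  have h2 : ∀ᶠ n in atTop, u n - v n < ε / 2 := huv.eventually_lt_const (by linarith)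
  have h3 : liminf u atTop - ε ≤ liminf v atTop := by
    refine le_liminf_of_le (bdd hv).2 ?_
    filter_upwards [h1, h2] with n hn1 hn2
    linarith
  linarith

namespace POMDP

section

variable {Ω A S : Type*} [DecidableEq Ω]

lemma etrajP_nonneg [Fintype Ω] [Fintype A] {M : POMDP Ω A S} (hM : M.IsValid) {h : ℝ}
    (hh : h ∈ Set.Ioo (0 : ℝ) 1) {σ : Strategy S A} (hσ : IsStrategy σ) :
    ∀ l : List (Ω × A × Bool), 0 ≤ etrajP M h σ l
  | [] => by simp [etrajP]
  | (ω, a, x) :: rest => by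
    unfold etrajP
    refine mul_nonneg (mul_nonneg (mul_nonneg ?_ (hσ.1 _ _)) ?_) (etrajP_nonneg hM hh hσ rest)
    · split
      · exact hM.2.2.1 _
      · split_ifs
        exacts [hM.1 _ _ _, zero_le_one, le_rfl]
    · split_ifs
      exacts [hh.1.le, by linarith [hh.2]]

lemma sum_etrajP_cons [Fintype Ω] [Fintype A] {M : POMDP Ω A S} (hM : M.IsValid) (h : ℝ)
    {σ : Strategy S A} (hσ : IsStrategy σ) (l : List (Ω × A × Bool)) (x : Bool) :
    ∑ ω, ∑ a, etrajP M h σ ((ω, a, x) :: l) = (if x then h else 1 - h) * etrajP M h σ l := by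
  simp only [etrajP, ← Finset.sum_mul, ← Finset.mul_sum, hσ.2, mul_one]
  congr 1
  convert one_mul _
  rcases l with _ | ⟨⟨ω', a', x'⟩, l⟩
  · exact hM.2.2.2
  · cases x' <;> simp [hM.2.1]

lemma ofFn_snoc {X : Type*} {n : ℕ} (t : Fin n → X) (y : X) :
    List.ofFn (Fin.snoc t y : Fin (n + 1) → X) = List.ofFn t ++ [y] := by
  rw [List.ofFn_succ']
  simp [List.concat_eq_append]

lemma sum_snoc {X : Type*} [Fintype X] {n : ℕ} (F : (Fin (n + 1) → X) → ℝ) :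
    ∑ tr, F tr = ∑ t : Fin n → X, ∑ y, F (Fin.snoc t y) := by
  rw [← (Fin.snocEquiv fun _ : Fin (n + 1) => X).sum_comp, Fintype.sum_prod_type_right]
  rfl

variable [Fintype Ω] [Fintype A] {M : POMDP Ω A S} {h : ℝ} {σ : Strategy S A}

lemma eP_nonneg (hM : M.IsValid) (hh : h ∈ Set.Ioo (0 : ℝ) 1) (hσ : IsStrategy σ) {n : ℕ}
    (tr : Fin n → Ω × A × Bool) : 0 ≤ eP M h σ tr :=
  etrajP_nonneg hM hh hσ _

lemma sum_eP_snoc (hM : M.IsValid) (hσ : IsStrategy σ) {n : ℕ} (t : Fin n → Ω × A × Bool)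
    (w : Bool → ℝ) :
    ∑ y : Ω × A × Bool, eP M h σ (Fin.snoc t y : Fin (n + 1) → _) * w y.2.2
      = (h * w true + (1 - h) * w false) * eP M h σ t := by
  have h1 := sum_etrajP_cons hM h hσ (List.ofFn t).reverse true
  have h2 := sum_etrajP_cons hM h hσ (List.ofFn t).reverse false
  simp only [if_true, Bool.false_eq_true, if_false] at h1 h2
  simp only [eP, ofFn_snoc, List.reverse_append, List.reverse_singleton, List.singleton_append,
    Fintype.sum_prod_type, Fintype.sum_bool, Finset.sum_add_distrib, ← Finset.sum_mul, h1, h2]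
  ring

lemma sum_eP (hM : M.IsValid) (hσ : IsStrategy σ) (n : ℕ) :
    ∑ t : Fin n → Ω × A × Bool, eP M h σ t = 1 := by
  induction n with
  | zero => simp [eP, etrajP]
  | succ n ih =>
    rw [sum_snoc, ← ih]
    refine Finset.sum_congr rfl fun t _ => ?_
    simpa using sum_eP_snoc (h := h) hM hσ t fun _ => 1

/-- Probability that fewer than `k` of the first `n` coins are `true`, i.e. that `T_k > n`. -/
noncomputable def coinTail (M : POMDP Ω A S) (h : ℝ) (σ : Strategy S A) (n k : ℕ) : ℝ :=
  ∑ t : Fin n → Ω × A × Bool,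
    if (List.ofFn t).countP (fun p => p.2.2) < k then eP M h σ t else 0

lemma isNegBinTail_coinTail (hM : M.IsValid) (hh : h ∈ Set.Ioo (0 : ℝ) 1) (hσ : IsStrategy σ) :
    IsNegBinTail h (coinTail M h σ) where
  nonneg n k := Finset.sum_nonneg fun t _ => by
    split_ifs
    exacts [eP_nonneg hM hh hσ t, le_rfl]
  le_one n k := by
    rw [← sum_eP (h := h) hM hσ n]
    refine Finset.sum_le_sum fun t _ => ?_
    split_ifs
    exacts [le_rfl, eP_nonneg hM hh hσ t]
  zero_right n := by simp [coinTail]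
  zero_left k := by simp [coinTail, eP, etrajP]
  succ_succ n k := by
    simp only [coinTail, sum_snoc (n := n), Finset.mul_sum, ← Finset.sum_add_distrib]
    refine Finset.sum_congr rfl fun t _ => ?_
    have h1 := sum_eP_snoc (h := h) hM hσ t fun x =>
      if (List.ofFn t).countP (fun p => p.2.2) + (if x then 1 else 0) < k + 1 then 1 else 0
    simp only [mul_ite, mul_one, mul_zero, if_true, Bool.false_eq_true, if_false, add_zero,
      add_lt_add_iff_right] at h1
    simp only [ofFn_snoc, List.countP_append, List.countP_singleton]
    rw [h1]
    split_ifs <;> ring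

lemma abs_sum_eP_mul_g_le (hM : M.IsValid) (hh : h ∈ Set.Ioo (0 : ℝ) 1) (hσ : IsStrategy σ)
    {C : ℝ} (hC : ∀ ω a, |M.g ω a| ≤ C) {n : ℕ} (p : List (Ω × A × Bool) → Prop)
    [DecidablePred p] :
    |∑ tr : Fin (n + 1) → Ω × A × Bool, if p (List.ofFn tr).dropLast then
        eP M h σ tr * M.g (tr (Fin.last n)).1 (tr (Fin.last n)).2.1 else 0|
      ≤ C * ∑ t : Fin n → Ω × A × Bool, if p (List.ofFn t) then eP M h σ t else 0 := by
  rw [sum_snoc, Finset.mul_sum]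
  refine (Finset.abs_sum_le_sum_abs _ _).trans (Finset.sum_le_sum fun t _ => ?_)
  simp only [ofFn_snoc, List.dropLast_concat, Fin.snoc_last]
  split_ifs
  · have h1 := sum_eP_snoc (h := h) hM hσ t fun _ => C
    refine (Finset.abs_sum_le_sum_abs _ _).trans ((Finset.sum_le_sum fun y _ => ?_).trans
      (h1.trans (by ring)).le)
    rw [abs_mul, abs_of_nonneg (eP_nonneg hM hh hσ _)]
    exact mul_le_mul_of_nonneg_left (hC _ _) (eP_nonneg hM hh hσ _)
  · simp

/-- The stage-`(n+1)` payoff restricted to the event `n + 1 ≤ T_k`. -/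
noncomputable def stageBefore (M : POMDP Ω A S) (h : ℝ) (σ : Strategy S A) (k n : ℕ) : ℝ :=
  ∑ tr : Fin (n + 1) → Ω × A × Bool,
    if (List.ofFn tr).dropLast.countP (fun p => p.2.2) < k then
      eP M h σ tr * M.g (tr (Fin.last n)).1 (tr (Fin.last n)).2.1
    else 0

lemma abs_stageEext_le (hM : M.IsValid) (hh : h ∈ Set.Ioo (0 : ℝ) 1) (hσ : IsStrategy σ)
    {C : ℝ} (hC : ∀ ω a, |M.g ω a| ≤ C) (n : ℕ) : |stageEext M h σ n| ≤ C := by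
  simpa [sum_eP hM hσ, stageEext] using
    abs_sum_eP_mul_g_le hM hh hσ hC (n := n) fun _ => True

lemma abs_stageBefore_sub_le (hM : M.IsValid) (hh : h ∈ Set.Ioo (0 : ℝ) 1) (hσ : IsStrategy σ)
    {C : ℝ} (hC : ∀ ω a, |M.g ω a| ≤ C) (k t n : ℕ) :
    |stageBefore M h σ k n - if n < t then stageEext M h σ n else 0|
      ≤ C * |coinTail M h σ n k - if n < t then 1 else 0| := by
  have hb := isNegBinTail_coinTail hM hh hσ
  split_ifs with hnt
  · rw [abs_sub_comm, abs_sub_comm _ (1 : ℝ), abs_of_nonneg (sub_nonneg.2 (hb.le_one n k))]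
    have h1 := abs_sum_eP_mul_g_le hM hh hσ hC (n := n)
      fun l => ¬ l.countP (fun p => p.2.2) < k
    convert h1 using 2
    · rw [stageEext, stageBefore, ← Finset.sum_sub_distrib]
      refine Finset.sum_congr rfl fun tr _ => ?_
      split_ifs <;> simp_all
    · rw [← sum_eP (h := h) hM hσ n, coinTail, ← Finset.sum_sub_distrib]
      refine Finset.sum_congr rfl fun tr _ => ?_
      split_ifs <;> simp_all
  · rw [sub_zero, sub_zero, abs_of_nonneg (hb.nonneg n k)]
    exact abs_sum_eP_mul_g_le hM hh hσ hC fun l => l.countP (fun p => p.2.2) < k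

/-- The expected payoff up to `T_k` differs from the one up to stage `t` by at most
`C * 𝔼|T_k - t|`. -/
lemma abs_EuptoT_sub_le (hM : M.IsValid) (hh : h ∈ Set.Ioo (0 : ℝ) 1) (hσ : IsStrategy σ)
    {C : ℝ} (hC0 : 0 ≤ C) (hC : ∀ ω a, |M.g ω a| ≤ C) (k t s : ℕ) (hs : 0 < s) :
    |EuptoT M h σ k - ∑ j ∈ Finset.range t, stageEext M h σ j|
      ≤ C * (2 * s + (k * (1 - h) / h ^ 2 + (k / h - t) ^ 2) / s) := by
  obtain ⟨hsum, hle⟩ := (isNegBinTail_coinTail hM hh hσ).abs_dev_le hh k t s hs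
  have hI : HasSum (fun n => if n < t then stageEext M h σ n else 0)
      (∑ j ∈ Finset.range t, stageEext M h σ j) := by
    have h1 := hasSum_sum_of_ne_finset_zero (L := .unconditional ℕ) (s := Finset.range t)
      (f := fun n : ℕ => if n < t then stageEext M h σ n else 0)
      (by intro n hn; simp at hn; simp [hn])
    convert h1 using 1
    exact Finset.sum_congr rfl fun n hn => (if_pos (Finset.mem_range.1 hn)).symm
  have hbound := abs_stageBefore_sub_le hM hh hσ hC k t
  have hd : Summable fun n => stageBefore M h σ k n - if n < t then stageEext M h σ n else 0 :=
    Summable.of_norm_bounded (hsum.mul_left C) hbound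
  have hE : HasSum (stageBefore M h σ k) (EuptoT M h σ k) := by
    have h1 : Summable (stageBefore M h σ k) := by
      simpa using hd.add hI.summable
    exact h1.hasSum
  rw [← (hE.sub hI).tsum_eq, ← Real.norm_eq_abs]
  refine (tsum_of_norm_bounded (hsum.mul_left C).hasSum hbound).trans ?_
  rw [tsum_mul_left]
  exact mul_le_mul_of_nonneg_left hle hC0

end

end POMDP

open POMDP in
/-- With `t_k = ⌊k/h⌋`,
`liminf_k E^h_σ[(1/t_k) ∑_{j=1}^{t_k} g(ω'_j, a'_j)]
  = liminf_k E^h_σ[(h/k) ∑_{j=1}^{T_k} g(ω'_j, a'_j)]`. -/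
theorem liminf_floor_eq_liminf_Tk {Ω A S : Type*} [Fintype Ω] [Fintype A] [DecidableEq Ω]
    (M : POMDP Ω A S) (hM : M.IsValid) (h : ℝ) (hh : h ∈ Set.Ioo (0 : ℝ) 1)
    (σ : Strategy S A) (hσ : IsStrategy σ) :
    liminf (fun k : ℕ =>
        (1 / (⌊(k : ℝ) / h⌋₊ : ℝ)) * ∑ j ∈ Finset.range ⌊(k : ℝ) / h⌋₊, stageEext M h σ j)
        atTop
      = liminf (fun k : ℕ => (h / (k : ℝ)) * EuptoT M h σ k) atTop := by
  obtain ⟨h0, h1⟩ := id hh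
  set C : ℝ := ∑ ω, ∑ a, |M.g ω a|
  have hC0 : 0 ≤ C := by positivity
  have hC : ∀ ω a, |M.g ω a| ≤ C := fun ω a =>
    (Finset.single_le_sum (f := fun a => |M.g ω a|) (fun _ _ => abs_nonneg _)
      (Finset.mem_univ a)).trans
      (Finset.single_le_sum (f := fun ω => ∑ a, |M.g ω a|)
        (fun _ _ => Finset.sum_nonneg fun _ _ => abs_nonneg _) (Finset.mem_univ ω))
  set u : ℕ → ℝ := fun k =>
    (1 / (⌊(k : ℝ) / h⌋₊ : ℝ)) * ∑ j ∈ Finset.range ⌊(k : ℝ) / h⌋₊, stageEext M h σ j with hu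
  set v : ℕ → ℝ := fun k => (h / (k : ℝ)) * EuptoT M h σ k with hv
  have hsum : ∀ t, |∑ j ∈ Finset.range t, stageEext M h σ j| ≤ C * t := fun t => by
    refine (Finset.abs_sum_le_sum_abs _ _).trans
      ((Finset.sum_le_sum fun j _ => abs_stageEext_le hM hh hσ hC j).trans ?_)
    simp [mul_comm]
  have hub : ∀ k, |u k| ≤ C := fun k => by
    simp only [hu]
    rw [abs_mul, abs_of_nonneg (by positivity), one_div_mul_eq_div]
    exact div_le_of_le_mul₀ (Nat.cast_nonneg _) hC0 (hsum _)
  have key : ∀ k s : ℕ, 0 < k → 0 < s →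
      |u k - v k| ≤ C * h / k + C * (2 * h * (s / k) + ((1 - h) / h + h / k) / s) := by
    intro k s hk hs
    have hk' : (1 : ℝ) ≤ k := by exact_mod_cast hk
    have hs' : (0 : ℝ) < s := by exact_mod_cast hs
    have hE := abs_EuptoT_sub_le hM hh hσ hC0 hC k ⌊(k : ℝ) / h⌋₊ s hs
    have hA := hsum ⌊(k : ℝ) / h⌋₊
    have ht1 : (⌊(k : ℝ) / h⌋₊ : ℝ) ≤ k / h := Nat.floor_le (by positivity)
    have ht2 : (k : ℝ) / h < ⌊(k : ℝ) / h⌋₊ + 1 := Nat.lt_floor_add_one _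
    have ht0 : (0 : ℝ) < ⌊(k : ℝ) / h⌋₊ := by
      have : (1 : ℝ) ≤ k / h := by rw [le_div_iff₀ h0]; linarith
      exact_mod_cast Nat.floor_pos.2 this
    simp only [hu, hv]
    generalize (∑ j ∈ Finset.range ⌊(k : ℝ) / h⌋₊, stageEext M h σ j) = a at *
    generalize (⌊(k : ℝ) / h⌋₊ : ℝ) = t at *
    generalize EuptoT M h σ k = e at *
    have e1 : 1 / t * a - h / k * e = (h / k * (k / h - t)) * (a / t) - h / k * (e - a) := by
      field_simp
      ring
    rw [e1]
    refine (abs_sub _ _).trans (add_le_add ?_ ?_)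
    · rw [abs_mul, abs_mul, abs_of_nonneg (by positivity : 0 ≤ h / k),
        abs_of_nonneg (sub_nonneg.2 ht1), abs_div, abs_of_pos ht0]
      calc h / k * (k / h - t) * (|a| / t) ≤ h / k * 1 * C := by
            gcongr
            · linarith
            · exact div_le_of_le_mul₀ ht0.le hC0 hA
        _ = C * h / k := by ring
    · rw [abs_mul, abs_of_nonneg (by positivity : 0 ≤ h / k)]
      have hsq : (k / h - t) ^ 2 ≤ 1 := by nlinarith
      calc h / k * |e - a| ≤ h / k * (C * (2 * s + (k * (1 - h) / h ^ 2 + 1) / s)) := by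
            refine mul_le_mul_of_nonneg_left (hE.trans ?_) (by positivity)
            gcongr
        _ = C * (2 * h * (s / k) + ((1 - h) / h + h / k) / s) := by
            field_simp
  have hlim : Tendsto (fun n => u n - v n) atTop (nhds 0) := by
    have hk : Tendsto (fun k : ℕ => (k : ℝ)) atTop atTop := tendsto_natCast_atTop_atTop
    have hs : Tendsto (fun k : ℕ => Nat.sqrt k) atTop atTop :=
      tendsto_atTop_atTop.2 fun b => ⟨b * b, fun a ha => Nat.le_sqrt.2 ha⟩
    have hs' : Tendsto (fun k : ℕ => (Nat.sqrt k : ℝ)) atTop atTop := hk.comp hs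
    have hsk : Tendsto (fun k : ℕ => (Nat.sqrt k : ℝ) / k) atTop (nhds 0) := by
      refine squeeze_zero' (.of_forall fun k => by positivity) ?_
        (tendsto_inv_atTop_zero.comp hs')
      filter_upwards [eventually_gt_atTop 0] with k hk0
      have hp : (0 : ℝ) < Nat.sqrt k := by exact_mod_cast Nat.sqrt_pos.2 hk0
      have hk1 : (0 : ℝ) < k := by exact_mod_cast hk0
      have hq : (Nat.sqrt k : ℝ) * Nat.sqrt k ≤ k := by exact_mod_cast Nat.sqrt_le k
      rw [Function.comp_apply, div_le_iff₀ hk1, inv_mul_eq_div, le_div_iff₀ hp]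
      exact hq
    have hfin : Tendsto (fun k : ℕ => C * h / k + C * (2 * h * ((Nat.sqrt k : ℝ) / k) +
        ((1 - h) / h + h / k) / (Nat.sqrt k : ℝ))) atTop
        (nhds (0 + C * (2 * h * 0 + 0))) :=
      (hk.const_div_atTop _).add (((hsk.const_mul _).add
        ((tendsto_const_nhds.add (hk.const_div_atTop h)).div_atTop hs')).const_mul C)
    simp only [mul_zero, add_zero] at hfin
    refine squeeze_zero_norm' ?_ hfin
    filter_upwards [eventually_gt_atTop 0] with k hk0
    exact key k _ hk0 (Nat.sqrt_pos.2 hk0)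
  have hvb : ∀ᶠ k in atTop, |v k| ≤ C + 1 := by
    filter_upwards [hlim.eventually (Metric.ball_mem_nhds 0 one_pos)] with k hk
    have h2 : |u k - v k| < 1 := by simpa using hk
    have h3 := abs_sub_abs_le_abs_sub (v k) (u k)
    rw [abs_sub_comm] at h3
    linarith [hub k]
  have hub' : ∀ᶠ k in atTop, |u k| ≤ C + 1 := .of_forall fun k => (hub k).trans (by linarith)
  refine le_antisymm (liminf_le_liminf_of_tendsto_sub hub' hvb hlim)
    (liminf_le_liminf_of_tendsto_sub hvb hub' ?_)
  simpa using hlim.neg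
end

section
/- Let M be a positive integer, let (x_n)_{n≥1} be a real sequence, and let (x_{n_k})_{k≥1} be a subsequence of (x_n) (with n_1 < n_2 < …). Suppose that lim_{j→∞} (x_{j+1} − x_j) = 0 and that n_{j+1} − n_j ≤ M for all j ≥ 1. Then liminf_{n→∞} x_n = liminf_{k→∞} x_{n_k} (liminf taken in the extended reals). -/
open Filter

/-- A strictly increasing sequence of naturals cuts `[n 0, ∞)` into the blocks
`[n k, n (k + 1))`. -/
lemma StrictMono.exists_nat_block {n : ℕ → ℕ} (hn : StrictMono n) {j : ℕ} (hj : n 0 ≤ j) :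
    ∃ k, n k ≤ j ∧ j < n (k + 1) := by
  induction j, hj using Nat.le_induction with
  | base => exact ⟨0, le_rfl, hn (Nat.lt_succ_self 0)⟩
  | succ j _ ih =>
    obtain ⟨k, h₁, h₂⟩ := ih
    rcases Nat.lt_or_ge (j + 1) (n (k + 1)) with h | h
    · exact ⟨k, by omega, h⟩
    · exact ⟨k + 1, h, lt_of_le_of_lt h₂ (hn (Nat.lt_succ_self _))⟩

/-- If the increments of `x` are at least `-ε` from `N` on, then `x` drops by at most `d * ε`
in `d` steps. -/
lemma sub_mul_le_of_increments {x : ℕ → ℝ} {ε : ℝ} {N : ℕ}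
    (h : ∀ j ≥ N, -ε ≤ x (j + 1) - x j) {m : ℕ} (hm : N ≤ m) (d : ℕ) :
    x m - d * ε ≤ x (m + d) := by
  induction d with
  | zero => simp
  | succ d ih =>
    have := h (m + d) (by omega)
    rw [← add_assoc]
    push_cast
    linarith

/-- If `(x_n)` satisfies `x_{j+1} - x_j → 0` and `(x_{n_k})` is a
subsequence along strictly increasing indices with gaps `n_{j+1} - n_j ≤ M`, then
`liminf x_n = liminf x_{n_k}` (in the extended reals). -/
theorem liminf_subseq_of_small_gaps (M : ℕ) (hM : 0 < M)
    (x : ℕ → ℝ) (n : ℕ → ℕ) (hmono : StrictMono n)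
    (hdiff : Tendsto (fun j => x (j + 1) - x j) atTop (nhds 0))
    (hgap : ∀ j, n (j + 1) - n j ≤ M) :
    liminf (fun j => (x j : EReal)) atTop = liminf (fun k => (x (n k) : EReal)) atTop := by
  apply le_antisymm
  · exact hmono.tendsto_atTop.liminf_le_liminf_comp (u := fun j => (x j : EReal))
  rw [← EReal.ge_of_forall_gt_iff_ge]
  intro c hc
  obtain ⟨b, hcb, hb⟩ := EReal.lt_iff_exists_real_btwn.1 hc
  have hcb : c < b := EReal.coe_lt_coe_iff.1 hcb
  have hM' : (0 : ℝ) < M := Nat.cast_pos.2 hM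
  have hε : 0 < (b - c) / M := div_pos (sub_pos.2 hcb) hM'
  obtain ⟨K, hK⟩ := eventually_atTop.1 (eventually_lt_of_lt_liminf hb)
  obtain ⟨N, hN⟩ := eventually_atTop.1 (hdiff.eventually_const_le (neg_lt_zero.2 hε))
  refine le_liminf_of_le (by isBoundedDefault) (eventually_atTop.2 ⟨n (max K N), fun j hj => ?_⟩)
  obtain ⟨k, hk₁, hk₂⟩ := hmono.exists_nat_block ((hmono.monotone (Nat.zero_le _)).trans hj)
  have hk : max K N < k + 1 := hmono.lt_iff_lt.1 (lt_of_le_of_lt hj hk₂)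
  have hxk : b < x (n k) := EReal.coe_lt_coe_iff.1 (hK k (by omega))
  have hnk : N ≤ n k := le_trans (by omega) (hmono.le_apply (x := k))
  obtain ⟨d, rfl⟩ := Nat.exists_eq_add_of_le hk₁
  have hd : (d : ℝ) ≤ M := Nat.cast_le.2 (by have := hgap k; omega)
  have hdrop := sub_mul_le_of_increments hN hnk d
  have hdε : d * ((b - c) / M) ≤ b - c := by
    calc d * ((b - c) / M) ≤ M * ((b - c) / M) := by gcongr
      _ = b - c := mul_div_cancel₀ _ hM'.ne'
  exact EReal.coe_le_coe_iff.2 (by linarith)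
end
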